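/- arXiv:2503.18101 — 2 statements merged into one kernel-verified Lean document; each statement's English description precedes it below -/
import Mathlib

section
/- Let H be a finite abelian strongly sequenceable group. There exist constants c_1 > 0, C_2 ≥ C_1 > 0 and p_0 (depending on H) such that for every prime p ≥ p_0, every homomorphism φ: H → Aut(Z_p) satisfying property (⋆), and every nonempty subset A ⊆ (Z_p ⋊_φ H) \ {id}, setting R(A) := c_1·max((log p)^{1/2}, log p / log |A|), there exist ψ ∈ Aut(Z_p ⋊_φ H), an integer s ≥ 0, a partition ψ(A) = E ∪ D_1 ∪ ⋯ ∪ D_s, a partition {1, …, s} = L_0 ∪ L_1, and for each j ∈ L_1 a partition D_j = D_j^o ∪ D_j^e with |D_j^o| = |D_j^e|, such that: (i) dim(E) < R(A); and moreover, if s > 0: (ii) each D_j is a dissociated set with C_1·R(A) ≤ |D_j| ≤ C_2·R(A) and |D_j| divisible by 8; (iii) 1 and s belong to the same set L_i, π_2(D_j) ⊆ H_1 for every j ∈ L_1, and π_2(D_j) ⊆ H_0 for every j ∈ L_0; (iv) the element δ := (∏_{j∈L_1} (alternating product of D_j^o and D_j^e, with elements of D_j^o in odd positions and elements of D_j^e in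 even positions))·(∏_{j∈L_0} ∏_{d∈D_j} d), whose value is independent of all choices of orderings, satisfies δ = (z_0, a_0) with z_0 ≠ 0 and φ(a_0) = id, and π_1(E ∪ {δ}) ⊆ (−p/(90(|E|+1)), p/(90(|E|+1))); (v) D_1 ∪ D_s ∪ {δ} is dissociated. -/
open scoped Classical

/-- The partial products `p_i = l_1 ⋯ l_i` for `1 ≤ i ≤ n` are pairwise distinct
(valid ordering) and moreover `p_i ≠ 1` for `1 ≤ i ≤ n-1`. -/
def IsSequencing {G : Type*} [Group G] (l : List G) : Prop :=
  (∀ i ∈ Finset.Icc 1 l.length, ∀ j ∈ Finset.Icc 1 l.length,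
    (l.take i).prod = (l.take j).prod → i = j) ∧
  ∀ i ∈ Finset.Ico 1 l.length, (l.take i).prod ≠ 1

/-- `l` is a sequencing of the finite set `A`. -/
def IsSequencingOf {G : Type*} [Group G] (l : List G) (A : Finset G) : Prop :=
  l.Nodup ∧ l.toFinset = A ∧ IsSequencing l

/-- Every finite subset of `G \ {1}` is sequenceable. -/
def StronglySequenceable (G : Type*) [Group G] : Prop :=
  ∀ A : Finset G, (1 : G) ∉ A → ∃ l : List G, IsSequencingOf l A

/-- Property (⋆): every `φ h` is the identity or the negation automorphism of `ℤ/p`. -/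
def PropertyStar {p : ℕ} {H : Type*} [Group H]
    (φ : H →* MulAut (Multiplicative (ZMod p))) : Prop :=
  ∀ h : H, φ h = 1 ∨ φ h = MulEquiv.inv (Multiplicative (ZMod p))

/-- `D` is dissociated: no nonempty product of distinct elements of `D`, each raised to
the power `1` or `-1`, in any order, equals the identity.  (This is equivalent to the
formulation with a permutation of all of `D` and exponents in `{-1,0,1}`, not all `0`:
simply drop the factors with exponent `0`.) -/
def IsDissociated {G : Type*} [Group G] (D : Set G) : Prop :=
  ∀ l : List (G × ℤ), l ≠ [] → (l.map Prod.fst).Nodup →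
    (∀ x ∈ l, x.1 ∈ D ∧ (x.2 = 1 ∨ x.2 = -1)) →
    (l.map fun x => x.1 ^ x.2).prod ≠ 1

/-- `interleave l₁ l₂` alternates the two lists, starting with `l₁`: the elements of
`l₁` occupy the odd positions and the elements of `l₂` the even positions. -/
def interleave {α : Type*} : List α → List α → List α
  | [], l => l
  | a :: l, l' => a :: interleave l' l
termination_by l₁ l₂ => l₁.length + l₂.length
decreasing_by simp; omega

/-- The dimension of a finite set `B`: the size of the largest dissociated subset. -/
noncomputable def dimension {G : Type*} [Group G] (B : Finset G) : ℕ :=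
  sSup { n | ∃ D : Finset G, D ⊆ B ∧ IsDissociated (D : Set G) ∧ D.card = n }

section Dissociated

variable {G : Type*} [Group G]

/-- `l` lists distinct elements of `D`, each with an exponent `1` or `-1`. -/
def IsSignedWord (D : Set G) (l : List (G × ℤ)) : Prop :=
  (l.map Prod.fst).Nodup ∧ ∀ x ∈ l, x.1 ∈ D ∧ (x.2 = 1 ∨ x.2 = -1)

/-- The elements of `G` which are products of distinct elements of `D`, each raised to the
power `1` or `-1`. -/
def signedSpan (D : Set G) : Set G :=
  {g | ∃ l, IsSignedWord D l ∧ (l.map fun x => x.1 ^ x.2).prod = g}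

theorem inv_mem_signedSpan {D : Set G} {g : G} (hg : g ∈ signedSpan D) :
    g⁻¹ ∈ signedSpan D := by
  obtain ⟨l, ⟨hn, hl⟩, rfl⟩ := hg
  refine ⟨(l.map fun x => (x.1, -x.2)).reverse, ⟨?_, ?_⟩, ?_⟩
  · simpa [List.map_reverse, Function.comp_def] using hn
  · intro x hx
    simp only [List.mem_reverse, List.mem_map] at hx
    obtain ⟨y, hy, rfl⟩ := hx
    obtain ⟨h1, h2⟩ := hl y hy
    refine ⟨h1, ?_⟩
    rcases h2 with h2 | h2 <;> simp [h2]
  · rw [List.prod_inv_reverse]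
    simp [List.map_reverse, Function.comp_def]

theorem subset_signedSpan (D : Set G) : D ⊆ signedSpan D := fun g hg =>
  ⟨[(g, 1)], ⟨by simp, by simpa using hg⟩, by simp⟩

theorem IsDissociated.mono {D D' : Set G} (h : IsDissociated D') (hD : D ⊆ D') :
    IsDissociated D :=
  fun l h1 h2 h3 => h l h1 h2 fun x hx => ⟨hD (h3 x hx).1, (h3 x hx).2⟩

theorem isDissociated_empty : IsDissociated (∅ : Set G) := by
  intro l h1 _ h3
  obtain ⟨x, l, rfl⟩ := List.exists_cons_of_ne_nil h1
  exact absurd (h3 x (by simp)).1 (Set.notMem_empty _)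

theorem mem_signedSpan_of_not_isDissociated_insert {D : Set G} (hD : IsDissociated D) {e : G}
    (he : ¬ IsDissociated (insert e D)) : e ∈ signedSpan D := by
  by_cases heD : e ∈ D
  · exact subset_signedSpan D heD
  unfold IsDissociated at he
  push Not at he
  obtain ⟨l, h1, h2, h3, h4⟩ := he
  by_cases hel : e ∈ l.map Prod.fst
  · obtain ⟨⟨e', ε⟩, hx, rfl⟩ := List.mem_map.1 hel
    obtain ⟨l₁, l₂, rfl⟩ := List.append_of_mem hx
    have hw : IsSignedWord D (l₂ ++ l₁) := by
      have h2' : (((e', ε) :: (l₂ ++ l₁)).map Prod.fst).Nodup := by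
        refine (List.Perm.nodup_iff ?_).1 h2
        refine List.Perm.map _ ?_
        exact List.perm_middle.trans (List.Perm.cons _ List.perm_append_comm)
      rw [List.map_cons, List.nodup_cons] at h2'
      refine ⟨h2'.2, fun x hx => ?_⟩
      have hx' : x ∈ l₁ ++ (e', ε) :: l₂ := by
        simp only [List.mem_append, List.mem_cons] at hx ⊢
        tauto
      refine ⟨?_, (h3 x hx').2⟩
      refine ((h3 x hx').1).resolve_left fun h => h2'.1 ?_
      exact List.mem_map.2 ⟨x, hx, h⟩
    have hp : e' ^ (-ε) ∈ signedSpan D := by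
      refine ⟨_, hw, ?_⟩
      simp only [List.map_append, List.map_cons, List.prod_append, List.prod_cons] at h4 ⊢
      rw [zpow_neg, eq_inv_iff_mul_eq_one]
      rwa [mul_eq_one_comm, ← mul_assoc, mul_eq_one_comm]
    rcases (h3 _ hx).2 with h | h
    · have h' : ε = 1 := h
      simpa [h'] using inv_mem_signedSpan hp
    · have h' : ε = -1 := h
      simpa [h'] using hp
  · refine absurd h4 (hD l h1 h2 fun x hx => ⟨?_, (h3 x hx).2⟩)
    exact ((h3 x hx).1).resolve_left fun h => hel (List.mem_map.2 ⟨x, hx, h⟩)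

theorem IsDissociated.prod_ne_prod {D : Set G} (hD : IsDissociated D) {l₁ l₂ : List G}
    (hn : (l₁ ++ l₂).Nodup) (hne : l₁ ++ l₂ ≠ []) (hmem : ∀ x ∈ l₁ ++ l₂, x ∈ D) :
    l₁.prod ≠ l₂.prod := by
  intro h
  refine hD (l₁.map (fun x => (x, 1)) ++ (l₂.map fun x => (x, -1)).reverse) ?_ ?_ ?_ ?_
  · simpa using hne
  · simp only [List.map_append, List.map_reverse, List.map_map, Function.comp_def, List.map_id']
    exact ((List.reverse_perm l₂).append_left l₁).nodup_iff.2 hn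
  · intro x hx
    simp only [List.mem_append, List.mem_map, List.mem_reverse] at hx
    rcases hx with ⟨y, hy, rfl⟩ | ⟨y, hy, rfl⟩
    · exact ⟨hmem _ (by simp [hy]), by simp⟩
    · exact ⟨hmem _ (by simp [hy]), by simp⟩
  · have h2 : (l₂.map fun x => x⁻¹).reverse.prod = l₁.prod⁻¹ := by
      rw [h, List.prod_inv_reverse]
    simp [List.map_reverse, Function.comp_def, h2]

theorem IsDissociated.image {G' : Type*} [Group G'] (ψ : G ≃* G') {D : Set G}
    (hD : IsDissociated D) : IsDissociated (ψ '' D) := by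
  intro l h1 h2 h3 h4
  refine hD (l.map fun x => (ψ.symm x.1, x.2)) (by simpa using h1) ?_ ?_ ?_
  · have : ((l.map Prod.fst).map ψ.symm).Nodup := h2.map ψ.symm.injective
    simpa [Function.comp_def] using this
  · intro x hx
    obtain ⟨y, hy, rfl⟩ := List.mem_map.1 hx
    obtain ⟨⟨d, hd, hdy⟩, h⟩ := h3 y hy
    refine ⟨?_, h⟩
    simp only [← hdy, MulEquiv.symm_apply_apply]
    exact hd
  · have := congrArg ψ.symm h4
    simpa [map_list_prod, Function.comp_def] using this

theorem bddAbove_card_isDissociated (B : Finset G) :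
    BddAbove { n | ∃ D : Finset G, D ⊆ B ∧ IsDissociated (D : Set G) ∧ D.card = n } :=
  ⟨B.card, by rintro n ⟨D, hD, -, rfl⟩; exact Finset.card_le_card hD⟩

theorem card_le_dimension {B D : Finset G} (hDB : D ⊆ B) (hD : IsDissociated (D : Set G)) :
    D.card ≤ dimension B :=
  le_csSup (bddAbove_card_isDissociated B) ⟨D, hDB, hD, rfl⟩

theorem exists_card_eq_dimension (B : Finset G) :
    ∃ D : Finset G, D ⊆ B ∧ IsDissociated (D : Set G) ∧ D.card = dimension B :=
  Nat.sSup_mem (s := { n | ∃ D : Finset G, D ⊆ B ∧ IsDissociated (D : Set G) ∧ D.card = n })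
    ⟨0, ∅, by simp, by simpa using isDissociated_empty, rfl⟩ (bddAbove_card_isDissociated B)

theorem dimension_le_of_forall {B : Finset G} {n : ℕ}
    (h : ∀ D : Finset G, D ⊆ B → IsDissociated (D : Set G) → D.card ≤ n) : dimension B ≤ n := by
  obtain ⟨D, h1, h2, h3⟩ := exists_card_eq_dimension B
  exact h3 ▸ h D h1 h2

theorem dimension_union_le [DecidableEq G] (B C : Finset G) :
    dimension (B ∪ C) ≤ dimension B + C.card := by
  refine dimension_le_of_forall fun D hD hd => ?_
  have h1 : (D \ C).card ≤ dimension B := by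
    refine card_le_dimension ?_ (hd.mono (by simp))
    intro x hx
    rw [Finset.mem_sdiff] at hx
    exact (Finset.mem_union.1 (hD hx.1)).resolve_right hx.2
  have h2 := Finset.card_le_card_sdiff_add_card (s := D) (t := C)
  omega

theorem dimension_image_le {G' : Type*} [Group G'] [DecidableEq G'] (ψ : G ≃* G')
    (B : Finset G) : dimension (B.image ψ) ≤ dimension B := by
  classical
  refine dimension_le_of_forall fun D hD hd => ?_
  have h1 := hd.image ψ.symm
  rw [← Finset.card_image_of_injective D ψ.symm.injective]
  refine card_le_dimension ?_ (by simpa using h1)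
  intro x hx
  obtain ⟨y, hy, rfl⟩ := Finset.mem_image.1 hx
  obtain ⟨z, hz, rfl⟩ := Finset.mem_image.1 (hD hy)
  simpa using hz

theorem exists_isDissociated_forall_mem_signedSpan (B : Finset G) :
    ∃ D : Finset G, D ⊆ B ∧ D.card = dimension B ∧ ∀ g ∈ B, g ∈ signedSpan (D : Set G) := by
  classical
  obtain ⟨D, h1, h2, h3⟩ := exists_card_eq_dimension B
  refine ⟨D, h1, h3, fun g hg => ?_⟩
  by_cases hgD : g ∈ D
  · exact subset_signedSpan _ (by simpa using hgD)
  refine mem_signedSpan_of_not_isDissociated_insert h2 fun h => ?_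
  have := card_le_dimension (B := B) (D := insert g D) (Finset.insert_subset hg h1)
    (by simpa using h)
  rw [Finset.card_insert_of_notMem hgD] at this
  omega

end Dissociated

theorem interleave_nil {α : Type*} (l : List α) : interleave [] l = l := by
  rw [interleave]

theorem interleave_cons {α : Type*} (a : α) (l l' : List α) :
    interleave (a :: l) l' = a :: interleave l' l := by
  rw [interleave]

theorem interleave_perm {α : Type*} (l l' : List α) : (interleave l l').Perm (l ++ l') := by
  induction l, l' using interleave.induct with
  | case1 l => rw [interleave_nil]; simp
  | case2 a l l' ih =>
    rw [interleave_cons, List.cons_append]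
    exact (ih.trans List.perm_append_comm).cons a

theorem map_interleave {α β : Type*} (f : α → β) (l l' : List α) :
    (interleave l l').map f = interleave (l.map f) (l'.map f) := by
  induction l, l' using interleave.induct with
  | case1 l => simp [interleave_nil]
  | case2 a l l' ih => rw [interleave_cons, List.map_cons, List.map_cons, interleave_cons, ih]

/-- `δ` is the product of the alternating products of `Do j` and `De j` for `j ∈ L₁` and of
the products of `D j` for `j ∈ L₀`, whatever orderings are used. -/
def IsAlternatingProduct {G : Type*} [Group G] [DecidableEq G] {s : ℕ}
    (D Do De : Fin s → Finset G) (L₀ L₁ : Finset (Fin s)) (δ : G) : Prop :=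
  ∀ (lo le : Fin s → List G) (l₁ l₀ : List (Fin s)),
    l₁.Nodup → l₁.toFinset = L₁ → l₀.Nodup → l₀.toFinset = L₀ →
    (∀ j ∈ L₁, (lo j).Nodup ∧ (lo j).toFinset = Do j ∧ (le j).Nodup ∧ (le j).toFinset = De j) →
    (∀ j ∈ L₀, (lo j).Nodup ∧ (lo j).toFinset = D j) →
    (l₁.map fun j => (interleave (lo j) (le j)).prod).prod *
      (l₀.map fun j => (lo j).prod).prod = δ

theorem IsAlternatingProduct.image {G : Type*} [Group G] [DecidableEq G] {s : ℕ}
    {D Do De : Fin s → Finset G} {L₀ L₁ : Finset (Fin s)} {δ : G}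
    (h : IsAlternatingProduct D Do De L₀ L₁ δ) (ψ : G ≃* G) :
    IsAlternatingProduct (fun j => (D j).image ψ) (fun j => (Do j).image ψ)
      (fun j => (De j).image ψ) L₀ L₁ (ψ δ) := by
  have key : ∀ {l : List G} {S : Finset G}, l.toFinset = S.image ψ →
      (l.map ψ.symm).toFinset = S := by
    intro l S hl
    ext x
    have := congrArg (fun T => ψ x ∈ T) hl
    simpa [MulEquiv.symm_apply_eq] using this
  intro lo le l₁ l₀ h1 h2 h3 h4 h5 h6
  have := h (fun j => (lo j).map ψ.symm) (fun j => (le j).map ψ.symm) l₁ l₀ h1 h2 h3 h4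
    (fun j hj => ⟨(h5 j hj).1.map ψ.symm.injective, key (h5 j hj).2.1,
      (h5 j hj).2.2.1.map ψ.symm.injective, key (h5 j hj).2.2.2⟩)
    (fun j hj => ⟨(h6 j hj).1.map ψ.symm.injective, key (h6 j hj).2⟩)
  simp only [← map_interleave, ← map_list_prod] at this
  simp only [← this, map_mul, map_list_prod ψ, List.map_map, Function.comp_def,
    MulEquiv.apply_symm_apply]

section SemidirectProduct

variable {N H : Type*} [CommGroup N] [CommGroup H] {φ : H →* MulAut N}

/-- `g` acts on `N` by `x ↦ x ^ t`. -/
def HasSign (t : ℤˣ) (g : N ⋊[φ] H) : Prop :=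
  ∀ x, φ g.right x = x ^ (t : ℤ)

theorem zpow_units_zpow_units (x : N) (t : ℤˣ) : (x ^ (t : ℤ)) ^ (t : ℤ) = x := by
  rw [← zpow_mul, ← Units.val_mul, Int.units_mul_self, Units.val_one, zpow_one]

theorem interleave_prod_of_hasSign {t : ℤˣ} {lo le : List (N ⋊[φ] H)}
    (hlen : lo.length = le.length) (ho : ∀ g ∈ lo, HasSign t g) (he : ∀ g ∈ le, HasSign t g) :
    (interleave lo le).prod =
      ⟨(lo.map fun g => g.left).prod * (le.map fun g => g.left).prod ^ (t : ℤ),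
        (lo.map fun g => g.right).prod * (le.map fun g => g.right).prod⟩ := by
  induction lo generalizing le with
  | nil =>
    obtain rfl : le = [] := List.length_eq_zero_iff.1 hlen.symm
    simp [interleave_nil]
  | cons a lo ih =>
    obtain ⟨b, le, rfl⟩ : ∃ b l, le = b :: l :=
      List.exists_cons_of_length_eq_add_one hlen.symm
    have ha : HasSign t a := ho a (by simp)
    have hb : HasSign t b := he b (by simp)
    have := ih (le := le) (by simpa using hlen) (fun g hg => ho g (by simp [hg]))
      (fun g hg => he g (by simp [hg]))
    rw [interleave_cons, interleave_cons, List.prod_cons, List.prod_cons, this]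
    ext
    · simp only [SemidirectProduct.mul_left, ha _, hb _,
        List.map_cons, List.prod_cons, mul_zpow, zpow_units_zpow_units]
      simp only [mul_assoc, mul_left_comm]
    · simp only [SemidirectProduct.mul_right, List.map_cons, List.prod_cons]
      simp only [mul_assoc, mul_left_comm]

theorem prod_map_mk_of_apply_eq_one {ι : Type*} {v : ι → N × H} {l : List ι}
    (h : ∀ i ∈ l, φ (v i).2 = 1) :
    (l.map fun i => (⟨(v i).1, (v i).2⟩ : N ⋊[φ] H)).prod =
      ⟨(l.map v).prod.1, (l.map v).prod.2⟩ := by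
  induction l with
  | nil => rfl
  | cons a l ih =>
    rw [List.map_cons, List.prod_cons, ih fun i hi => h i (by simp [hi])]
    ext <;> simp [h a (by simp)]

/-- The coordinates of the alternating products of `o` and `e`, all of whose elements act
on `N` by `x ↦ x ^ t`. -/
def alternatingValue (t : ℤˣ) (o e : Finset (N ⋊[φ] H)) : N × H :=
  ((∏ g ∈ o, g.left) * (∏ g ∈ e, g.left) ^ (t : ℤ), (∏ g ∈ o, g.right) * ∏ g ∈ e, g.right)

theorem alternatingValue_union [DecidableEq (N ⋊[φ] H)] {t : ℤˣ}
    {o e o' e' : Finset (N ⋊[φ] H)} (ho : Disjoint o o') (he : Disjoint e e') :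
    alternatingValue t (o ∪ o') (e ∪ e') = alternatingValue t o e * alternatingValue t o' e' := by
  ext
  · simp only [alternatingValue, Finset.prod_union ho, Finset.prod_union he, mul_zpow,
      Prod.fst_mul]
    simp only [mul_assoc, mul_left_comm]
  · simp only [alternatingValue, Finset.prod_union ho, Finset.prod_union he, Prod.snd_mul]
    simp only [mul_assoc, mul_left_comm]

theorem apply_alternatingValue_snd {t : ℤˣ} {o e : Finset (N ⋊[φ] H)} (hcard : o.card = e.card)
    (ho : ∀ g ∈ o, HasSign t g) (he : ∀ g ∈ e, HasSign t g) :
    φ (alternatingValue t o e).2 = 1 := by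
  have key : ∀ (n : ℕ) (s : Finset (N ⋊[φ] H)), s.card = n → (∀ g ∈ s, HasSign t g) →
      ∀ x, φ (∏ g ∈ s, g.right) x = x ^ ((t ^ n : ℤˣ) : ℤ) := by
    classical
    intro n s
    induction s using Finset.induction_on generalizing n with
    | empty => rintro rfl _ x; simp
    | insert a s ha ih =>
      intro hn hs x
      rw [Finset.card_insert_of_notMem ha] at hn
      subst hn
      rw [Finset.prod_insert ha, map_mul, MulAut.mul_apply,
        ih _ rfl (fun g hg => hs g (by simp [hg])), hs a (by simp), pow_succ, Units.val_mul,
        zpow_mul]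
  ext x
  rw [alternatingValue, map_mul, MulAut.mul_apply, key _ e rfl he, key _ o hcard ho,
    zpow_units_zpow_units, MulAut.one_apply]

theorem interleave_prod_of_toFinset [DecidableEq (N ⋊[φ] H)] {t : ℤˣ} {o e : Finset (N ⋊[φ] H)}
    {lo le : List (N ⋊[φ] H)} (hcard : o.card = e.card)
    (ho : ∀ g ∈ o, HasSign t g) (he : ∀ g ∈ e, HasSign t g)
    (hlo : lo.Nodup) (hle : le.Nodup) (hlo' : lo.toFinset = o) (hle' : le.toFinset = e) :
    (interleave lo le).prod = ⟨(alternatingValue t o e).1, (alternatingValue t o e).2⟩ := by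
  subst hlo' hle'
  rw [List.toFinset_card_of_nodup hlo, List.toFinset_card_of_nodup hle] at hcard
  rw [interleave_prod_of_hasSign hcard (fun g hg => ho g (by simpa using hg))
    (fun g hg => he g (by simpa using hg))]
  simp only [alternatingValue, List.prod_toFinset _ hlo, List.prod_toFinset _ hle]

theorem isAlternatingProduct_of_hasSign [DecidableEq (N ⋊[φ] H)] {s : ℕ}
    {Do De : Fin s → Finset (N ⋊[φ] H)} {t : Fin s → ℤˣ} (hdisj : ∀ j, Disjoint (Do j) (De j))
    (hcard : ∀ j, (Do j).card = (De j).card) (ho : ∀ j, ∀ g ∈ Do j, HasSign (t j) g)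
    (he : ∀ j, ∀ g ∈ De j, HasSign (t j) g) :
    IsAlternatingProduct (fun j => Do j ∪ De j) Do De (Finset.univ.filter fun j => t j = 1)
      (Finset.univ.filter fun j => t j ≠ 1)
      ⟨(∏ j, alternatingValue (t j) (Do j) (De j)).1,
        (∏ j, alternatingValue (t j) (Do j) (De j)).2⟩ := by
  intro lo le l₁ l₀ h1 h1' h0 h0' hL1 hL0
  set v : Fin s → N × H := fun j => alternatingValue (t j) (Do j) (De j) with hv
  have hφ : ∀ j, φ (v j).2 = 1 := fun j =>
    apply_alternatingValue_snd (hcard j) (ho j) (he j)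
  have e1 : (l₁.map fun j => (interleave (lo j) (le j)).prod) =
      l₁.map fun j => (⟨(v j).1, (v j).2⟩ : N ⋊[φ] H) := by
    refine List.map_congr_left fun j hj => ?_
    have hj' : j ∈ Finset.univ.filter fun j => t j ≠ 1 := h1' ▸ List.mem_toFinset.2 hj
    obtain ⟨a, b, c, d⟩ := hL1 j hj'
    exact interleave_prod_of_toFinset (hcard j) (ho j) (he j) a c b d
  have e0 : (l₀.map fun j => (lo j).prod) =
      l₀.map fun j => (⟨(v j).1, (v j).2⟩ : N ⋊[φ] H) := by
    refine List.map_congr_left fun j hj => ?_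
    have hj' : j ∈ Finset.univ.filter fun j => t j = 1 := h0' ▸ List.mem_toFinset.2 hj
    obtain ⟨a, b⟩ := hL0 j hj'
    replace b : (lo j).toFinset = Do j ∪ De j := b
    have ht : t j = 1 := (Finset.mem_filter.1 hj').2
    have hs : ∀ g ∈ lo j, φ (g.left, g.right).2 = 1 := by
      intro g hg
      have hg' : g ∈ Do j ∪ De j := b ▸ List.mem_toFinset.2 hg
      ext x
      rcases Finset.mem_union.1 hg' with h | h
      · simpa [ht] using ho j g h x
      · simpa [ht] using he j g h x
    have := prod_map_mk_of_apply_eq_one (φ := φ) hs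
    simp only [List.map_id'] at this
    rw [this, hv]
    have hp : ((lo j).map fun g => (g.left, g.right)).prod =
        alternatingValue (t j) (Do j) (De j) := by
      rw [← List.prod_toFinset _ a, b, Finset.prod_union (hdisj j)]
      ext <;> simp [alternatingValue, ht, Prod.fst_prod, Prod.snd_prod]
    rw [hp]
  rw [e1, e0, ← List.prod_append, ← List.map_append,
    prod_map_mk_of_apply_eq_one fun j _ => hφ j]
  have hn : (l₁ ++ l₀).Nodup := by
    refine List.nodup_append'.2 ⟨h1, h0, ?_⟩
    intro j hj hj'
    have a : j ∈ Finset.univ.filter fun j => t j ≠ 1 := h1' ▸ List.mem_toFinset.2 hj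
    have b : j ∈ Finset.univ.filter fun j => t j = 1 := h0' ▸ List.mem_toFinset.2 hj'
    exact (Finset.mem_filter.1 a).2 (Finset.mem_filter.1 b).2
  have hu : (l₁ ++ l₀).toFinset = Finset.univ := by
    rw [List.toFinset_append, h1', h0', Finset.union_comm, Finset.filter_union_filter_not_eq]
  rw [← List.prod_toFinset _ hn, hu]

theorem exists_exponents_of_mem_signedSpan
    (hφ : ∀ h : H, ∃ t : ℤˣ, ∀ x, φ h x = x ^ (t : ℤ)) {T : Finset (N ⋊[φ] H)}
    {g : N ⋊[φ] H} (hg : g ∈ signedSpan (T : Set (N ⋊[φ] H))) :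
    ∃ c : N ⋊[φ] H → ℤ, (∀ x, c x = -1 ∨ c x = 0 ∨ c x = 1) ∧
      g.left = ∏ x ∈ T, x.left ^ c x := by
  classical
  obtain ⟨l, hl, rfl⟩ := hg
  suffices h : ∃ c : N ⋊[φ] H → ℤ, (∀ x, c x = -1 ∨ c x = 0 ∨ c x = 1) ∧
      (∀ x ∉ l.map Prod.fst, c x = 0) ∧
      (l.map fun x : (N ⋊[φ] H) × ℤ => x.1 ^ x.2).prod.left = ∏ x ∈ T, x.left ^ c x by
    obtain ⟨c, h1, -, h2⟩ := h
    exact ⟨c, h1, h2⟩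
  induction l with
  | nil => exact ⟨0, by simp, by simp, by simp⟩
  | cons a l ih =>
    obtain ⟨hn, hmem⟩ := hl
    rw [List.map_cons, List.nodup_cons] at hn
    obtain ⟨c, h1, h2, h3⟩ := ih ⟨hn.2, fun x hx => hmem x (by simp [hx])⟩
    obtain ⟨haT, ha⟩ := hmem a (by simp)
    obtain ⟨t, ht⟩ := hφ (a.1 ^ a.2).right
    have hleft : ∃ u : ℤ, (u = -1 ∨ u = 0 ∨ u = 1) ∧ (a.1 ^ a.2).left = a.1.left ^ u := by
      rcases ha with ha | ha
      · exact ⟨1, by simp, by simp [ha]⟩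
      · obtain ⟨r, hr⟩ := hφ (a.1.right)⁻¹
        refine ⟨-r, ?_, ?_⟩
        · rcases Int.units_eq_one_or r with rfl | rfl <;> simp
        · rw [ha, zpow_neg_one, SemidirectProduct.inv_left, hr, inv_zpow, zpow_neg]
    obtain ⟨u, hu, hleft⟩ := hleft
    refine ⟨Function.update (fun x => c x * t) a.1 u, fun x => ?_, fun x hx => ?_, ?_⟩
    · by_cases hx : x = a.1
      · subst hx; simpa using hu
      · rw [Function.update_of_ne hx]
        rcases Int.units_eq_one_or t with rfl | rfl <;> rcases h1 x with h | h | h <;> simp [h]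
    · simp only [List.map_cons, List.mem_cons, not_or] at hx
      rw [Function.update_of_ne hx.1, h2 x hx.2, zero_mul]
    · rw [List.map_cons, List.prod_cons, SemidirectProduct.mul_left, ht, h3, hleft]
      have hc : c a.1 = 0 := h2 _ hn.1
      rw [← Finset.prod_zpow, ← Finset.mul_prod_erase T (fun x => (x.left ^ c x) ^ (t : ℤ)) haT,
        ← Finset.mul_prod_erase T _ haT, hc]
      simp only [zpow_zero, one_zpow, one_mul, Function.update_self]
      congr 1
      refine Finset.prod_congr rfl fun x hx => ?_
      rw [Function.update_of_ne (Finset.ne_of_mem_erase hx), zpow_mul]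

theorem exists_finset_signedSpan_subset [Fintype H]
    (hφ : ∀ h : H, ∃ t : ℤˣ, ∀ x, φ h x = x ^ (t : ℤ)) (T : Finset (N ⋊[φ] H)) :
    ∃ S : Finset (N × H), S.card ≤ 3 ^ T.card * Fintype.card H ∧
      ∀ g ∈ signedSpan (T : Set (N ⋊[φ] H)), (g.left, g.right) ∈ S := by
  classical
  refine ⟨(Finset.univ : Finset ((T → Fin 3) × H)).image fun c =>
    (∏ x : T, x.1.left ^ (((c.1 x : ℕ) : ℤ) - 1), c.2), ?_, ?_⟩
  · refine Finset.card_image_le.trans ?_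
    simp [Finset.card_univ]
  · intro g hg
    obtain ⟨c, h1, h2⟩ := exists_exponents_of_mem_signedSpan hφ hg
    have h3 : ∀ x, ∃ i : Fin 3, c x = ((i : ℕ) : ℤ) - 1 := by
      intro x
      rcases h1 x with h | h | h
      · exact ⟨0, by simp [h]⟩
      · exact ⟨1, by simp [h]⟩
      · exact ⟨2, by simp [h]⟩
    choose i hi using h3
    refine Finset.mem_image.2 ⟨(fun x => i x, g.right), Finset.mem_univ _, ?_⟩
    simp only [h2, hi]
    exact congrArg (·, g.right) (Finset.prod_coe_sort T fun x => x.left ^ (((i x : ℕ) : ℤ) - 1))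

theorem exists_hasSign_subset (hφ : ∀ h : H, ∃ t : ℤˣ, ∀ x, φ h x = x ^ (t : ℤ)) {m : ℕ}
    {D : Finset (N ⋊[φ] H)} (hD : 2 * m ≤ D.card) :
    ∃ (t : ℤˣ) (D' : Finset (N ⋊[φ] H)), D' ⊆ D ∧ D'.card = m ∧ ∀ g ∈ D', HasSign t g := by
  classical
  have h : ∃ t : ℤˣ, m ≤ (D.filter (HasSign t)).card := by
    by_contra! hlt
    have h1 := hlt 1
    have h2 := hlt (-1)
    have : D ⊆ D.filter (HasSign 1) ∪ D.filter (HasSign (-1)) := by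
      intro g hg
      obtain ⟨t, ht⟩ := hφ g.right
      rcases Int.units_eq_one_or t with rfl | rfl
      · exact Finset.mem_union_left _ (Finset.mem_filter.2 ⟨hg, ht⟩)
      · exact Finset.mem_union_right _ (Finset.mem_filter.2 ⟨hg, ht⟩)
    have := (Finset.card_le_card this).trans (Finset.card_union_le _ _)
    omega
  obtain ⟨t, ht⟩ := h
  obtain ⟨D', h1, h2⟩ := Finset.exists_subset_card_eq ht
  exact ⟨t, D', h1.trans (Finset.filter_subset _ _), h2,
    fun g hg => (Finset.mem_filter.1 (h1 hg)).2⟩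

end SemidirectProduct

section Blocks

/-- A finite set split into two parts, together with a sign. -/
structure SignedBlock (G : Type*) where
  /-- the exponent describing the action of the elements of the block -/
  sign : ℤˣ
  /-- the elements used in odd positions -/
  odd : Finset G
  /-- the elements used in even positions -/
  even : Finset G

/-- The underlying set of a block. -/
def SignedBlock.support {G : Type*} [DecidableEq G] (b : SignedBlock G) : Finset G :=
  b.odd ∪ b.even

variable {N H : Type*} [CommGroup N] [CommGroup H] {φ : H →* MulAut N}

/-- The blocks from which the decompositions are built. -/
structure SignedBlock.IsValid [DecidableEq (N ⋊[φ] H)] (k : ℕ)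
    (b : SignedBlock (N ⋊[φ] H)) : Prop where
  disjoint : Disjoint b.odd b.even
  card_eq : b.odd.card = b.even.card
  odd_sign : ∀ g ∈ b.odd, HasSign b.sign g
  even_sign : ∀ g ∈ b.even, HasSign b.sign g
  dissociated : IsDissociated (b.support : Set (N ⋊[φ] H))
  dvd : 8 ∣ b.support.card
  le_card : 8 * k ≤ b.support.card
  card_le : b.support.card ≤ 264 * k

/-- The part with label `b` of the octets with index in `J`. -/
def octets {G ι : Type*} (f : ι × Fin 4 × Bool ↪ G) (J : Finset ι) (b : Bool) : Finset G :=
  (J ×ˢ (Finset.univ : Finset (Fin 4)) ×ˢ {b}).map f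

section Octets

variable {G ι : Type*} (f : ι × Fin 4 × Bool ↪ G)

theorem card_octets (J : Finset ι) (b : Bool) : (octets f J b).card = 4 * J.card := by
  simp [octets, mul_comm]

theorem mem_octets {J : Finset ι} {b : Bool} {g : G} :
    g ∈ octets f J b ↔ ∃ i ∈ J, ∃ q, f (i, q, b) = g := by
  simp only [octets, Finset.mem_map, Finset.mem_product, Finset.mem_univ, true_and,
    Finset.mem_singleton]
  constructor
  · rintro ⟨⟨i, q, b'⟩, ⟨hi, rfl⟩, h⟩
    exact ⟨i, hi, q, h⟩
  · rintro ⟨i, hi, q, h⟩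
    exact ⟨(i, q, b), ⟨hi, rfl⟩, h⟩

theorem disjoint_octets_of_disjoint {J J' : Finset ι} (h : Disjoint J J') (b b' : Bool) :
    Disjoint (octets f J b) (octets f J' b') := by
  rw [Finset.disjoint_left]
  intro g hg hg'
  obtain ⟨i, hi, q, rfl⟩ := (mem_octets f).1 hg
  obtain ⟨i', hi', q', he⟩ := (mem_octets f).1 hg'
  have := f.injective he
  simp only [Prod.mk.injEq] at this
  exact Finset.disjoint_left.1 h hi (this.1 ▸ hi')

theorem disjoint_octets_of_ne (J J' : Finset ι) {b b' : Bool} (h : b ≠ b') :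
    Disjoint (octets f J b) (octets f J' b') := by
  rw [Finset.disjoint_left]
  intro g hg hg'
  obtain ⟨i, hi, q, rfl⟩ := (mem_octets f).1 hg
  obtain ⟨i', hi', q', he⟩ := (mem_octets f).1 hg'
  have := f.injective he
  simp only [Prod.mk.injEq] at this
  exact h this.2.2.symm

theorem octets_union [DecidableEq G] [DecidableEq ι] (J J' : Finset ι) (b : Bool) :
    octets f (J ∪ J') b = octets f J b ∪ octets f J' b := by
  rw [octets, octets, octets, ← Finset.map_union, Finset.union_product]

/-- The octets with index in `J`, as a block. -/
def octetBlock (t : ℤˣ) (J : Finset ι) : SignedBlock G :=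
  ⟨t, octets f J true, octets f J false⟩

variable [DecidableEq G]

theorem mem_support_octetBlock {t : ℤˣ} {J : Finset ι} {g : G} :
    g ∈ (octetBlock f t J).support ↔ ∃ i ∈ J, ∃ q, f (i, q) = g := by
  simp only [octetBlock, SignedBlock.support, Finset.mem_union, mem_octets, Prod.exists,
    Bool.exists_bool]
  constructor
  · rintro (⟨i, hi, q, h⟩ | ⟨i, hi, q, h⟩)
    · exact ⟨i, hi, q, Or.inr h⟩
    · exact ⟨i, hi, q, Or.inl h⟩
  · rintro ⟨i, hi, q, h | h⟩
    · exact Or.inr ⟨i, hi, q, h⟩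
    · exact Or.inl ⟨i, hi, q, h⟩

theorem card_support_octetBlock (t : ℤˣ) (J : Finset ι) :
    (octetBlock f t J).support.card = 8 * J.card := by
  rw [SignedBlock.support, Finset.card_union_of_disjoint]
  · simp only [octetBlock, card_octets]
    ring
  · exact disjoint_octets_of_ne f _ _ (by simp)

theorem disjoint_support_octetBlock (t : ℤˣ) {J J' : Finset ι} (h : Disjoint J J') :
    Disjoint (octetBlock f t J).support (octetBlock f t J').support := by
  simp only [SignedBlock.support, octetBlock, Finset.disjoint_union_left,
    Finset.disjoint_union_right]
  exact ⟨⟨disjoint_octets_of_disjoint f h _ _, disjoint_octets_of_disjoint f h _ _⟩,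
    disjoint_octets_of_disjoint f h _ _, disjoint_octets_of_disjoint f h _ _⟩

end Octets

variable [DecidableEq (N ⋊[φ] H)] {ι : Type*} (f : ι × Fin 4 × Bool ↪ N ⋊[φ] H) {t : ℤˣ}

theorem isValid_octetBlock {k : ℕ} (hf : IsDissociated (Set.range f))
    (ht : ∀ i, HasSign t (f i)) {J : Finset ι} (h1 : k ≤ J.card) (h2 : J.card ≤ 33 * k) :
    (octetBlock f t J).IsValid k where
  disjoint := disjoint_octets_of_ne f _ _ (by simp)
  card_eq := by simp only [octetBlock, card_octets]
  odd_sign g hg := by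
    obtain ⟨i, hi, q, rfl⟩ := (mem_octets f).1 hg
    exact ht _
  even_sign g hg := by
    obtain ⟨i, hi, q, rfl⟩ := (mem_octets f).1 hg
    exact ht _
  dissociated := by
    refine hf.mono fun g hg => ?_
    obtain ⟨i, hi, q, rfl⟩ := (mem_support_octetBlock f).1 (Finset.mem_coe.1 hg)
    exact ⟨_, rfl⟩
  dvd := by simp [card_support_octetBlock]
  le_card := by rw [card_support_octetBlock]; omega
  card_le := by rw [card_support_octetBlock]; omega

/-- The coordinates of the product of a block. -/
def SignedBlock.value (b : SignedBlock (N ⋊[φ] H)) : N × H :=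
  alternatingValue b.sign b.odd b.even

theorem value_octetBlock_union [DecidableEq ι] {J J' : Finset ι} (h : Disjoint J J') :
    (octetBlock f t (J ∪ J')).value = (octetBlock f t J).value * (octetBlock f t J').value := by
  simp only [SignedBlock.value, octetBlock, octets_union]
  exact alternatingValue_union (disjoint_octets_of_disjoint f h _ _)
    (disjoint_octets_of_disjoint f h _ _)

theorem value_octetBlock_ne_of_disjoint (hf : IsDissociated (Set.range f))
    (ht : ∀ i, HasSign t (f i)) {J J' : Finset ι} (h : Disjoint J J')
    (hne : J.Nonempty ∨ J'.Nonempty) :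
    (octetBlock f t J).value ≠ (octetBlock f t J').value := by
  intro heq
  set w : Finset ι → List (N ⋊[φ] H) := fun J =>
    interleave (octets f J true).toList (octets f J false).toList with hw
  have hprod : ∀ J, (w J).prod =
      ⟨(octetBlock f t J).value.1, (octetBlock f t J).value.2⟩ := by
    intro J
    refine interleave_prod_of_toFinset (by simp only [octetBlock, card_octets]) ?_ ?_
      (Finset.nodup_toList _) (Finset.nodup_toList _) (Finset.toList_toFinset _)
      (Finset.toList_toFinset _)
    · intro g hg
      obtain ⟨i, hi, q, rfl⟩ := (mem_octets f).1 hg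
      exact ht _
    · intro g hg
      obtain ⟨i, hi, q, rfl⟩ := (mem_octets f).1 hg
      exact ht _
  have hmem : ∀ J g, g ∈ w J ↔ g ∈ (octetBlock f t J).support := by
    intro J g
    rw [hw, (interleave_perm _ _).mem_iff]
    simp [SignedBlock.support, octetBlock]
  have hnodup : ∀ J, (w J).Nodup := by
    intro J
    rw [hw, (interleave_perm _ _).nodup_iff]
    refine List.nodup_append'.2 ⟨Finset.nodup_toList _, Finset.nodup_toList _, ?_⟩
    intro g hg hg'
    exact Finset.disjoint_left.1 (disjoint_octets_of_ne f J J (b := true) (b' := false) (by simp))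
      (Finset.mem_toList.1 hg) (Finset.mem_toList.1 hg')
  refine hf.prod_ne_prod (l₁ := w J) (l₂ := w J') ?_ ?_ ?_ ?_
  · refine List.nodup_append'.2 ⟨hnodup _, hnodup _, fun g hg hg' => ?_⟩
    exact Finset.disjoint_left.1 (disjoint_support_octetBlock f t h) ((hmem _ _).1 hg)
      ((hmem _ _).1 hg')
  · have key : ∀ J : Finset ι, J.Nonempty → w J ≠ [] := by
      rintro J ⟨i, hi⟩
      exact List.ne_nil_of_mem ((hmem _ _).2 ((mem_support_octetBlock f).2
        ⟨i, hi, (0, true), rfl⟩))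
    rcases hne with hne | hne
    · simp [key J hne]
    · simp [key J' hne]
  · intro g hg
    have : g ∈ (octetBlock f t J).support ∨ g ∈ (octetBlock f t J').support := by
      simpa [hmem] using hg
    rcases this with h | h
    all_goals
      obtain ⟨i, hi, q, rfl⟩ := (mem_support_octetBlock f).1 h
      exact ⟨_, rfl⟩
  · rw [hprod, hprod, heq]

theorem value_octetBlock_injective [DecidableEq ι] (hf : IsDissociated (Set.range f))
    (ht : ∀ i, HasSign t (f i)) :
    Function.Injective fun J : Finset ι => (octetBlock f t J).value := by
  intro J J' h
  by_contra hne
  have h1 : (octetBlock f t J).value =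
      (octetBlock f t (J \ J')).value * (octetBlock f t (J ∩ J')).value := by
    rw [← value_octetBlock_union f (Finset.disjoint_sdiff_inter J J'), Finset.sdiff_union_inter]
  have h2 : (octetBlock f t J').value =
      (octetBlock f t (J' \ J)).value * (octetBlock f t (J ∩ J')).value := by
    rw [Finset.inter_comm, ← value_octetBlock_union f (Finset.disjoint_sdiff_inter J' J),
      Finset.sdiff_union_inter]
  simp only [h1, h2, mul_left_inj] at h
  refine value_octetBlock_ne_of_disjoint f hf ht disjoint_sdiff_sdiff ?_ h
  by_contra! hcon
  exact hne (Finset.Subset.antisymm (Finset.sdiff_eq_empty_iff_subset.1 hcon.1)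
    (Finset.sdiff_eq_empty_iff_subset.1 hcon.2))

theorem exists_subset_mul_value_notMem [DecidableEq ι] (hf : IsDissociated (Set.range f))
    (ht : ∀ i, HasSign t (f i)) (c : N × H) {J : Finset ι} {S : Finset (N × H)}
    (hS : S.card < 2 ^ J.card) : ∃ I ⊆ J, c * (octetBlock f t I).value ∉ S := by
  by_contra! h
  refine hS.not_ge ?_
  rw [← Finset.card_powerset]
  refine Finset.card_le_card_of_injOn (fun I => c * (octetBlock f t I).value)
    (fun I hI => h I (Finset.mem_powerset.1 hI)) ?_
  intro I _ I' _ hII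
  exact value_octetBlock_injective f hf ht (mul_left_cancel hII)

theorem exists_isValid_of_le_card (hφ : ∀ h : H, ∃ t : ℤˣ, ∀ x, φ h x = x ^ (t : ℤ)) {k : ℕ}
    {D : Finset (N ⋊[φ] H)} (hD : IsDissociated (D : Set (N ⋊[φ] H))) (hk : 16 * k ≤ D.card) :
    ∃ b : SignedBlock (N ⋊[φ] H), b.IsValid k ∧ b.support ⊆ D := by
  obtain ⟨t, D', h1, h2, h3⟩ := exists_hasSign_subset hφ (m := 8 * k) (D := D) (by omega)
  obtain ⟨o, ho, ho'⟩ := Finset.exists_subset_card_eq (s := D') (n := 4 * k) (by omega)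
  have hs : o ∪ D' \ o = D' := Finset.union_sdiff_of_subset ho
  refine ⟨⟨t, o, D' \ o⟩, ⟨Finset.disjoint_sdiff, ?_, fun g hg => h3 g (ho hg),
    fun g hg => h3 g (Finset.mem_sdiff.1 hg).1, ?_, ?_, ?_, ?_⟩, ?_⟩
  · have := Finset.card_sdiff_add_card_eq_card ho
    show o.card = (D' \ o).card
    omega
  · simp only [SignedBlock.support, hs]
    exact hD.mono (by simpa using h1)
  all_goals simp only [SignedBlock.support, hs, h2]
  · exact ⟨k, rfl⟩
  · exact le_rfl
  · omega
  · exact h1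

theorem exists_list_isValid (hφ : ∀ h : H, ∃ t : ℤˣ, ∀ x, φ h x = x ^ (t : ℤ)) {k : ℕ}
    (hk : 0 < k) (B : Finset (N ⋊[φ] H)) :
    ∃ (E : Finset (N ⋊[φ] H)) (l : List (SignedBlock (N ⋊[φ] H))),
      dimension E < 16 * k ∧ (∀ b ∈ l, b.IsValid k) ∧
      (∀ x, x ∈ B ↔ x ∈ E ∨ ∃ b ∈ l, x ∈ b.support) ∧ (∀ b ∈ l, Disjoint E b.support) ∧
      l.Pairwise fun b c => Disjoint b.support c.support := by
  induction B using Finset.strongInduction with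
  | H B ih =>
    by_cases hB : dimension B < 16 * k
    · exact ⟨B, [], hB, by simp, by simp, by simp, by simp⟩
    obtain ⟨D, h1, h2, h3⟩ := exists_card_eq_dimension B
    obtain ⟨b, hb, hbD⟩ := exists_isValid_of_le_card (k := k) hφ h2 (by omega)
    have hbB := hbD.trans h1
    have hne : b.support.Nonempty := by
      rw [← Finset.card_pos]
      have := hb.le_card
      omega
    obtain ⟨E, l, g1, g2, g3, g4, g5⟩ := ih (B \ b.support) (Finset.sdiff_ssubset hbB hne)
    refine ⟨E, b :: l, g1, ?_, ?_, ?_, ?_⟩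
    · simpa [hb] using g2
    · intro x
      have := g3 x
      simp only [Finset.mem_sdiff, List.mem_cons, exists_eq_or_imp] at this ⊢
      have h' := @hbB x
      by_cases hx : x ∈ b.support
      · simp [hx, h' hx]
      · simpa [hx] using this
    · simp only [List.mem_cons, forall_eq_or_imp]
      refine ⟨Finset.disjoint_left.2 fun x hx => ?_, g4⟩
      exact (Finset.mem_sdiff.1 ((g3 x).2 (Or.inl hx))).2
    · refine List.pairwise_cons.2 ⟨fun c hc => ?_, g5⟩
      refine (Finset.disjoint_left.2 fun x hx => ?_).symm
      exact (Finset.mem_sdiff.1 ((g3 x).2 (Or.inr ⟨c, hc, hx⟩))).2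

set_option maxHeartbeats 1000000 in
/-- A partition of `A` into blocks and a set of small dimension, with the product `δ` of all
the blocks in general position with respect to the first and the last one. -/
theorem exists_block_decomposition [Fintype H]
    (hφ : ∀ h : H, ∃ t : ℤˣ, ∀ x, φ h x = x ^ (t : ℤ)) {k : ℕ} (hk : 0 < k)
    (hcard : Fintype.card H * (3 ^ (16 * k) + 1) < 2 ^ (32 * k)) (A : Finset (N ⋊[φ] H))
    (hA : 560 * k ≤ dimension A) :
    ∃ (E : Finset (N ⋊[φ] H)) (l : List (SignedBlock (N ⋊[φ] H))) (hl : 0 < l.length),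
      dimension E < 272 * k ∧ (∀ b ∈ l, b.IsValid k) ∧
      (∀ x, x ∈ A ↔ x ∈ E ∨ ∃ b ∈ l, x ∈ b.support) ∧ (∀ b ∈ l, Disjoint E b.support) ∧
      (l.Pairwise fun b c => Disjoint b.support c.support) ∧
      l[0].sign = l[l.length - 1].sign ∧
      (l.map SignedBlock.value).prod.1 ≠ 1 ∧
      IsDissociated ((l[0].support ∪ l[l.length - 1].support ∪
        {⟨(l.map SignedBlock.value).prod.1, (l.map SignedBlock.value).prod.2⟩} :
        Finset (N ⋊[φ] H)) : Set (N ⋊[φ] H)) := by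
  obtain ⟨D, h1, h2, h3⟩ := exists_card_eq_dimension A
  obtain ⟨t, F, hF1, hF2, hF3⟩ := exists_hasSign_subset hφ (m := 280 * k) (D := D) (by omega)
  obtain ⟨f₀⟩ : Nonempty ((Fin k × Fin 35) × Fin 4 × Bool ↪ F) := by
    apply Function.Embedding.nonempty_of_card_le
    simp [hF2]
    omega
  set f : (Fin k × Fin 35) × Fin 4 × Bool ↪ N ⋊[φ] H :=
    f₀.trans (Function.Embedding.subtype _) with hf
  have hfF : ∀ i, f i ∈ F := fun i => (f₀ i).2
  have hft : ∀ i, HasSign t (f i) := fun i => hF3 _ (hfF i)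
  have hfd : IsDissociated (Set.range f) := by
    refine h2.mono ?_
    rintro _ ⟨i, rfl⟩
    exact hF1 (hfF i)
  set J : Finset (Fin 35) → Finset (Fin k × Fin 35) := fun K => Finset.univ ×ˢ K with hJ
  have hJc : ∀ K, (J K).card = k * K.card := by simp [hJ]
  have hJm : ∀ {i K}, i ∈ J K ↔ i.2 ∈ K := by simp [hJ, Finset.mem_product]
  have hJd : ∀ {K K'}, Disjoint K K' → Disjoint (J K) (J K') := fun h =>
    Finset.disjoint_product.2 (Or.inr h)
  obtain ⟨E', l, g1, g2, g3, g4, g5⟩ :=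
    exists_list_isValid hφ hk (A \ (octetBlock f t Finset.univ).support)
  set T := (octetBlock f t (J {0} ∪ J {1})).support with hT
  obtain ⟨S, hS1, hS2⟩ := exists_finset_signedSpan_subset hφ T
  have hTc : T.card = 16 * k := by
    rw [hT, card_support_octetBlock, Finset.card_union_of_disjoint (hJd (by decide)), hJc, hJc]
    simp
    ring
  set K₄ : Finset (Fin 35) := Finset.univ \ {0, 1, 2} with hK₄
  have hK₄c : K₄.card = 32 := by decide
  obtain ⟨I, hI, hIS⟩ := exists_subset_mul_value_notMem f hfd hft
    ((octetBlock f t (J {0})).value * ((octetBlock f t (J {2})).value *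
      ((l.map SignedBlock.value).prod * (octetBlock f t (J {1})).value))) (J := J K₄)
    (S := S ∪ {1} ×ˢ Finset.univ) (by
      rw [hJc, hK₄c, mul_comm k]
      refine lt_of_le_of_lt ?_ hcard
      refine (Finset.card_union_le _ _).trans ?_
      rw [hTc] at hS1
      simp only [Finset.card_product, Finset.card_singleton, Finset.card_univ]
      nlinarith)
  have hI2 : Disjoint (J {2}) I := (hJd (by decide)).mono_right hI
  have hI0 : Disjoint (J {0}) I := (hJd (by decide)).mono_right hI
  have hI1 : Disjoint (J {1}) I := (hJd (by decide)).mono_right hI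
  have h02 : Disjoint (J {0}) (J {2}) := hJd (by decide)
  have h01 : Disjoint (J {0}) (J {1}) := hJd (by decide)
  have h21 : Disjoint (J {2}) (J {1}) := hJd (by decide)
  have hR0 : Disjoint (J {0}) (J K₄ \ I) := (hJd (by decide)).mono_right Finset.sdiff_subset
  have hR1 : Disjoint (J {1}) (J K₄ \ I) := (hJd (by decide)).mono_right Finset.sdiff_subset
  have hR2 : Disjoint (J {2}) (J K₄ \ I) := (hJd (by decide)).mono_right Finset.sdiff_subset
  have hIc : I.card ≤ 32 * k := by
    refine (Finset.card_le_card hI).trans ?_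
    rw [hJc, hK₄c, mul_comm]
  set b₀ := octetBlock f t (J {0}) with hb₀
  set b₁ := octetBlock f t (J {1}) with hb₁
  set bm := octetBlock f t (J {2} ∪ I) with hbm
  set R := (octetBlock f t (J K₄ \ I)).support with hR
  have hval : ((b₀ :: bm :: (l ++ [b₁])).map SignedBlock.value).prod =
      b₀.value * ((octetBlock f t (J {2})).value *
      ((l.map SignedBlock.value).prod * b₁.value)) * (octetBlock f t I).value := by
    simp only [List.map_cons, List.map_append, List.map_nil, List.prod_cons, List.prod_append,
      List.prod_nil, mul_one, hbm, value_octetBlock_union f hI2]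
    have hcomm : ∀ a b i l c : N × H, a * (b * i * (l * c)) = a * (b * (l * c)) * i := by
      intro a b i l c
      rw [mul_right_comm b, mul_assoc a]
    exact hcomm _ _ _ _ _
  have hlast : (b₀ :: bm :: (l ++ [b₁]))[(b₀ :: bm :: (l ++ [b₁])).length - 1]'(by simp) =
      b₁ := by simp
  rw [← hval] at hIS
  rw [Finset.mem_union, not_or] at hIS
  have hsub : ∀ J', (octetBlock f t J').support ⊆ (octetBlock f t Finset.univ).support := by
    intro J' g hg
    obtain ⟨i, -, q, rfl⟩ := (mem_support_octetBlock f).1 hg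
    exact (mem_support_octetBlock f).2 ⟨i, Finset.mem_univ _, q, rfl⟩
  have hout : ∀ J', ∀ b ∈ l, Disjoint (octetBlock f t J').support b.support := by
    intro J' b hb
    refine Finset.disjoint_left.2 fun g hg hg' => ?_
    exact (Finset.mem_sdiff.1 ((g3 g).2 (Or.inr ⟨b, hb, hg'⟩))).2 (hsub _ hg)
  have hoE : ∀ J', Disjoint E' (octetBlock f t J').support := by
    intro J'
    refine Finset.disjoint_left.2 fun g hg hg' => ?_
    exact (Finset.mem_sdiff.1 ((g3 g).2 (Or.inl hg))).2 (hsub _ hg')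
  have hcover : ∀ x, x ∈ (octetBlock f t Finset.univ).support ↔
      x ∈ R ∨ x ∈ b₀.support ∨ x ∈ bm.support ∨ x ∈ b₁.support := by
    intro x
    constructor
    · intro hx
      obtain ⟨i, -, q, rfl⟩ := (mem_support_octetBlock f).1 hx
      simp only [hR, hb₀, hbm, hb₁]
      have key : ∀ J', i ∈ J' → f (i, q) ∈ (octetBlock f t J').support := fun J' hi =>
        (mem_support_octetBlock f).2 ⟨i, hi, q, rfl⟩
      by_cases hiI : i ∈ I
      · exact Or.inr (Or.inr (Or.inl (key _ (by simp [hiI]))))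
      have hi : i.2 = 0 ∨ i.2 = 2 ∨ i.2 = 1 ∨ i.2 ∈ K₄ := by
        simp only [hK₄, Finset.mem_sdiff, Finset.mem_univ, Finset.mem_insert,
          Finset.mem_singleton]
        tauto
      rcases hi with hi | hi | hi | hi
      · exact Or.inr (Or.inl (key _ (hJm.2 (by simp [hi]))))
      · exact Or.inr (Or.inr (Or.inl (key _ (Finset.mem_union_left _ (hJm.2 (by simp [hi]))))))
      · exact Or.inr (Or.inr (Or.inr (key _ (hJm.2 (by simp [hi])))))
      · exact Or.inl (key _ (Finset.mem_sdiff.2 ⟨hJm.2 hi, hiI⟩))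
    · rintro (hx | hx | hx | hx) <;> exact hsub _ hx
  have hFA : (octetBlock f t Finset.univ).support ⊆ A := by
    intro g hg
    obtain ⟨i, -, q, rfl⟩ := (mem_support_octetBlock f).1 hg
    exact h1 (hF1 (hfF _))
  have hprop : ∀ {a e r u v w c q : Prop}, (a ∧ ¬q ↔ e ∨ c) → (q ↔ r ∨ u ∨ v ∨ w) → (q → a) →
      (a ↔ (e ∨ r) ∨ u ∨ v ∨ c ∨ w) := by
    clear * -
    grind
  refine ⟨E' ∪ R, b₀ :: bm :: (l ++ [b₁]), by simp, ?_, ?_, ?_, ?_, ?_, ?_, ?_, ?_⟩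
  · refine (dimension_union_le _ _).trans_lt ?_
    have : (J K₄ \ I).card ≤ 32 * k := by
      refine (Finset.card_le_card Finset.sdiff_subset).trans ?_
      rw [hJc, hK₄c, mul_comm]
    rw [hR, card_support_octetBlock]
    omega
  · intro b hb
    simp only [List.mem_cons, List.mem_append, List.not_mem_nil, or_false] at hb
    rcases hb with rfl | rfl | hb | rfl
    · exact isValid_octetBlock f hfd hft (by simp [hJc]) (by simp [hJc]; omega)
    · have : (J {2} ∪ I).card = k + I.card := by
        rw [Finset.card_union_of_disjoint hI2, hJc]
        simp
      exact isValid_octetBlock f hfd hft (by omega) (by omega)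
    · exact g2 b hb
    · exact isValid_octetBlock f hfd hft (by simp [hJc]) (by simp [hJc]; omega)
  · intro x
    have a1 := g3 x
    have a2 := hcover x
    have a3 := @hFA x
    simp only [Finset.mem_sdiff, Finset.mem_union, List.mem_cons, List.mem_append,
      List.not_mem_nil, or_false, or_and_right, exists_or, exists_eq_left] at a1 ⊢
    exact hprop a1 a2 a3
  · intro b hb
    simp only [List.mem_cons, List.mem_append, List.not_mem_nil, or_false] at hb
    rw [Finset.disjoint_union_left]
    rcases hb with rfl | rfl | hb | rfl
    · exact ⟨hoE _, (disjoint_support_octetBlock f t hR0).symm⟩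
    · exact ⟨hoE _, (disjoint_support_octetBlock f t
        (Finset.disjoint_union_left.2 ⟨hR2, Finset.disjoint_sdiff⟩)).symm⟩
    · exact ⟨g4 b hb, hout _ b hb⟩
    · exact ⟨hoE _, (disjoint_support_octetBlock f t hR1).symm⟩
  · refine List.pairwise_cons.2 ⟨?_, List.pairwise_cons.2 ⟨?_, List.pairwise_append.2
      ⟨g5, by simp, ?_⟩⟩⟩
    · intro b hb
      simp only [List.mem_cons, List.mem_append, List.not_mem_nil, or_false] at hb
      rcases hb with rfl | hb | rfl
      · exact disjoint_support_octetBlock f t (Finset.disjoint_union_right.2 ⟨h02, hI0⟩)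
      · exact hout _ b hb
      · exact disjoint_support_octetBlock f t h01
    · intro b hb
      simp only [List.mem_cons, List.mem_append, List.not_mem_nil, or_false] at hb
      rcases hb with hb | rfl
      · exact hout _ b hb
      · exact disjoint_support_octetBlock f t (Finset.disjoint_union_left.2 ⟨h21, hI1.symm⟩)
    · intro b hb c hc
      obtain rfl : c = b₁ := by simpa using hc
      exact (hout _ b hb).symm
  · rw [hlast]
    rfl
  · intro h
    refine hIS.2 (Finset.mem_product.2 ⟨?_, Finset.mem_univ _⟩)
    simpa using h
  · rw [hlast]
    have hTd : IsDissociated (T : Set (N ⋊[φ] H)) := by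
      refine hfd.mono fun g hg => ?_
      obtain ⟨i, -, q, rfl⟩ := (mem_support_octetBlock f).1 (Finset.mem_coe.1 hg)
      exact ⟨_, rfl⟩
    have hTe : b₀.support ∪ b₁.support = T := by
      ext g
      simp only [hT, hb₀, hb₁, Finset.mem_union, mem_support_octetBlock, or_and_right, exists_or]
    show IsDissociated ((b₀.support ∪ b₁.support ∪ _ : Finset (N ⋊[φ] H)) : Set (N ⋊[φ] H))
    rw [hTe, Finset.union_comm, Finset.coe_union, Finset.coe_singleton, Set.singleton_union]
    by_contra hcon
    exact hIS.1 (hS2 _ (mem_signedSpan_of_not_isDissociated_insert hTd hcon))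

end Blocks

theorem exists_mul_small {p : ℕ} [Fact p.Prime] {ι : Type*} [Fintype ι] (x : ι → ZMod p) {Q : ℕ}
    (hQ : 0 < Q) (hQp : Q ^ Fintype.card ι < p) :
    ∃ u : ZMod p, u ≠ 0 ∧ ∀ i, ∃ k : ℤ, (k : ZMod p) = u * x i ∧ |k| * Q < p := by
  classical
  have hp : 0 < p := (Fact.out : p.Prime).pos
  obtain ⟨a, -, b, -, hab, h⟩ := Finset.exists_ne_map_eq_of_card_lt_of_maps_to
    (s := (Finset.univ : Finset (ZMod p))) (t := Fintype.piFinset fun _ : ι => Finset.range Q)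
    (f := fun u i => (u * x i).val * Q / p) (by simpa [ZMod.card] using hQp) (by
      intro u _
      simp only [Finset.mem_coe, Fintype.mem_piFinset, Finset.mem_range]
      intro i
      rw [Nat.div_lt_iff_lt_mul hp, mul_comm]
      exact Nat.mul_lt_mul_of_pos_left (ZMod.val_lt _) hQ)
  refine ⟨a - b, sub_ne_zero.2 hab, fun i => ?_⟩
  refine ⟨((a * x i).val : ℤ) - (b * x i).val, by simp [sub_mul], ?_⟩
  have hi : (a * x i).val * Q / p = (b * x i).val * Q / p := congrFun h i
  have h1 := Nat.div_add_mod ((a * x i).val * Q) p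
  have h2 := Nat.div_add_mod ((b * x i).val * Q) p
  have h3 := Nat.mod_lt ((a * x i).val * Q) hp
  have h4 := Nat.mod_lt ((b * x i).val * Q) hp
  rw [hi] at h1
  have hQ' : (0 : ℤ) ≤ Q := by positivity
  have habs : ∀ z : ℤ, |z| * Q = |z * Q| := fun z => by rw [abs_mul, abs_of_nonneg hQ']
  rw [habs, sub_mul, abs_lt]
  have h5 := Nat.zero_le ((a * x i).val * Q % p)
  have h6 := Nat.zero_le ((b * x i).val * Q % p)
  zify at h1 h2 h3 h4 h5 h6
  constructor <;> linarith

section Scaling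

variable {p : ℕ} [Fact p.Prime] {H : Type*} [CommGroup H]
  {φ : H →* MulAut (Multiplicative (ZMod p))}

theorem exists_scaling_small (hφ : ∀ h : H, ∃ t : ℤˣ, ∀ x, φ h x = x ^ (t : ℤ))
    (E : Finset (Multiplicative (ZMod p) ⋊[φ] H)) (δ : Multiplicative (ZMod p) ⋊[φ] H)
    (hE : (90 * (E.card + 1) * (dimension E + 1)) ^ (dimension E + 1) < p) :
    ∃ u : ZMod p, u ≠ 0 ∧ (∃ k : ℤ, (k : ZMod p) = u * Multiplicative.toAdd δ.left ∧
        |k| * (90 * (E.card + 1)) < p) ∧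
      ∀ g ∈ E, ∃ k : ℤ, (k : ZMod p) = u * Multiplicative.toAdd g.left ∧
        |k| * (90 * (E.card + 1)) < p := by
  classical
  obtain ⟨B, -, hB, hspan⟩ := exists_isDissociated_forall_mem_signedSpan E
  obtain ⟨u, hu, h⟩ := exists_mul_small
    (fun i : Option B => i.elim (Multiplicative.toAdd δ.left) fun b =>
      Multiplicative.toAdd b.1.left)
    (Q := 90 * (E.card + 1) * (dimension E + 1)) (by positivity) (by simpa [hB] using hE)
  have hp : (0 : ℤ) < p := by exact_mod_cast (Fact.out : p.Prime).pos
  choose k hk hkQ using h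
  push_cast at hkQ
  refine ⟨u, hu, ⟨k none, hk none, ?_⟩, fun g hg => ?_⟩
  · refine lt_of_le_of_lt ?_ (hkQ none)
    have h1 : (0 : ℤ) ≤ |k none| * (90 * (E.card + 1)) := by positivity
    have h2 : (1 : ℤ) ≤ dimension E + 1 := by omega
    exact (le_mul_of_one_le_right h1 h2).trans_eq (mul_assoc _ _ _)
  · obtain ⟨c, hc, hgc⟩ := exists_exponents_of_mem_signedSpan hφ (hspan g hg)
    refine ⟨∑ b : B, c b * k (some b), ?_, ?_⟩
    · rw [hgc, toAdd_prod, Finset.mul_sum, ← Finset.sum_coe_sort B, Int.cast_sum]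
      refine Finset.sum_congr rfl fun b _ => ?_
      rw [Int.cast_mul, hk, toAdd_zpow, zsmul_eq_mul]
      simp only [Option.elim_some]
      ring
    · have h1 : |∑ b : B, c b * k (some b)| ≤ ∑ b : B, |k (some b)| := by
        refine (Finset.abs_sum_le_sum_abs _ _).trans (Finset.sum_le_sum fun b _ => ?_)
        rw [abs_mul]
        refine mul_le_of_le_one_left (abs_nonneg _) ?_
        rcases hc b with h | h | h <;> simp [h]
      have h2 : (∑ b : B, |k (some b)|) * (90 * (E.card + 1) * (dimension E + 1)) ≤
          dimension E * p := by
        rw [Finset.sum_mul]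
        refine (Finset.sum_le_sum fun b _ => (hkQ (some b)).le).trans ?_
        simp [hB]
      have h3 : (0 : ℤ) < (dimension E : ℤ) + 1 := by positivity
      refine lt_of_mul_lt_mul_right (a := (dimension E : ℤ) + 1) ?_ h3.le
      calc _ = |∑ b : B, c b * k (some b)| * (90 * (E.card + 1) * (dimension E + 1)) := by ring
        _ ≤ (∑ b : B, |k (some b)|) * (90 * (E.card + 1) * (dimension E + 1)) := by gcongr
        _ ≤ dimension E * p := h2
        _ < p * (dimension E + 1) := by linarith

theorem card_le_of_dimension [Fintype H] (hφ : ∀ h : H, ∃ t : ℤˣ, ∀ x, φ h x = x ^ (t : ℤ))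
    (E : Finset (Multiplicative (ZMod p) ⋊[φ] H)) :
    E.card ≤ 3 ^ dimension E * Fintype.card H := by
  classical
  obtain ⟨B, -, hB, hspan⟩ := exists_isDissociated_forall_mem_signedSpan E
  obtain ⟨S, hS, hS'⟩ := exists_finset_signedSpan_subset hφ B
  rw [hB] at hS
  refine le_trans (Finset.card_le_card_of_injOn (fun g => (g.left, g.right))
    (fun g hg => hS' g (hspan g hg)) ?_) hS
  intro g _ g' _ h
  simp only [Prod.mk.injEq] at h
  exact SemidirectProduct.ext h.1 h.2

/-- Multiplication by `u ≠ 0` on the first coordinate. -/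
theorem exists_scaling_equiv (hφ : ∀ h : H, ∃ t : ℤˣ, ∀ x, φ h x = x ^ (t : ℤ)) {u : ZMod p}
    (hu : u ≠ 0) :
    ∃ ψ : (Multiplicative (ZMod p) ⋊[φ] H) ≃* (Multiplicative (ZMod p) ⋊[φ] H),
      ∀ g, Multiplicative.toAdd (ψ g).left = u * Multiplicative.toAdd g.left ∧
        (ψ g).right = g.right := by
  let e : Multiplicative (ZMod p) ≃* Multiplicative (ZMod p) :=
    AddEquiv.toMultiplicative (AddAut.mulLeft (Units.mk0 u hu))
  refine ⟨SemidirectProduct.congr e (MulEquiv.refl H) fun h => ?_, fun g => ⟨rfl, rfl⟩⟩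
  obtain ⟨t, ht⟩ := hφ h
  ext x
  simp [ht]

end Scaling

theorem pow_lt_of_log_bound {n k d m a p : ℕ} (hn : 0 < n) (hp : 0 < p) {R : ℝ}
    (hR : R = (1 / 2 : ℝ) * max (Real.log p ^ ((1 : ℝ) / 2)) (Real.log p / Real.log a))
    (hlog : 0 < Real.log p) (hkR : 560 * (k : ℝ) ≤ R) (hnk : n + 3 ≤ k) (hd : d < 272 * k)
    (hm : m ≤ 3 ^ d * n) (hma : m + 1 ≤ a) (hka : 560 * k ≤ a) :
    (90 * (m + 1) * (d + 1)) ^ (d + 1) < p := by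
  have hQ0 : (0 : ℝ) < ((90 * (m + 1) * (d + 1) : ℕ) : ℝ) := by positivity
  suffices h : ((d + 1 : ℕ) : ℝ) * Real.log ((90 * (m + 1) * (d + 1) : ℕ) : ℝ) < Real.log p by
    have h' : Real.log (((90 * (m + 1) * (d + 1) : ℕ) : ℝ) ^ (d + 1)) < Real.log p := by
      rw [Real.log_pow]
      exact h
    have := (Real.log_lt_log_iff (by positivity) (by exact_mod_cast hp)).1 h'
    exact_mod_cast this
  have hk1 : (1 : ℝ) ≤ k := by exact_mod_cast (by omega : 1 ≤ k)
  have hdk : ((d + 1 : ℕ) : ℝ) ≤ 272 * k := by exact_mod_cast hd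
  have hsq : (Real.log p ^ ((1 : ℝ) / 2)) ^ 2 = Real.log p := by
    rw [← Real.sqrt_eq_rpow, Real.sq_sqrt hlog.le]
  have hpos : 0 < Real.log p ^ ((1 : ℝ) / 2) := Real.rpow_pos_of_pos hlog _
  rcases le_total (Real.log p / Real.log a) (Real.log p ^ ((1 : ℝ) / 2)) with hle | hle
  · rw [max_eq_left hle] at hR
    have hQ : 90 * (m + 1) * (d + 1) ≤ 6 ^ (273 * k) := by
      have h1 : m + 1 ≤ 2 * (3 ^ d * n) := by
        have : 0 < 3 ^ d * n := by positivity
        omega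
      have h2 : d + 1 ≤ 2 ^ d := Nat.lt_two_pow_self
      have h3 : n ≤ 6 ^ n := (Nat.lt_pow_self (by norm_num)).le
      calc 90 * (m + 1) * (d + 1) ≤ 90 * (2 * (3 ^ d * n)) * 2 ^ d := by gcongr
        _ = 180 * n * 6 ^ d := by
          rw [show (6 : ℕ) = 3 * 2 by norm_num, mul_pow]
          ring
        _ ≤ 6 ^ 3 * 6 ^ n * 6 ^ d := by
          gcongr
          norm_num
        _ = 6 ^ (3 + n + d) := by rw [pow_add, pow_add]
        _ ≤ 6 ^ (273 * k) := Nat.pow_le_pow_right (by norm_num) (by omega)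
    have hlogQ : Real.log ((90 * (m + 1) * (d + 1) : ℕ) : ℝ) ≤ 546 * k := by
      have h6 : Real.log 6 ≤ 2 := by
        rw [Real.log_le_iff_le_exp (by norm_num)]
        have h1 := Real.exp_one_gt_d9
        have h2 : Real.exp 2 = Real.exp 1 * Real.exp 1 := by
          rw [← Real.exp_add]
          norm_num
        rw [h2]
        nlinarith
      calc _ ≤ Real.log ((6 : ℝ) ^ (273 * k)) :=
            Real.log_le_log hQ0 (by exact_mod_cast hQ)
        _ = (273 * k) * Real.log 6 := by
          rw [Real.log_pow]
          push_cast
          ring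
        _ ≤ (273 * k) * 2 := by gcongr
        _ = 546 * k := by ring
    calc _ ≤ (272 * (k : ℝ)) * (546 * k) := by
          refine mul_le_mul hdk hlogQ (Real.log_nonneg ?_) (by positivity)
          exact_mod_cast (by nlinarith : 1 ≤ 90 * (m + 1) * (d + 1))
      _ ≤ R * R := by
          refine mul_le_mul ?_ ?_ ?_ ?_ <;> linarith
      _ < Real.log p := by
          rw [hR]
          nlinarith
  · rw [max_eq_right hle] at hR
    have hloga : 0 < Real.log a := by
      by_contra hcon
      have := div_nonpos_of_nonneg_of_nonpos hlog.le (not_lt.1 hcon)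
      linarith
    have ha : (0 : ℝ) < a := by exact_mod_cast (by omega : 0 < a)
    have hQ : 90 * (m + 1) * (d + 1) ≤ a ^ 3 := by
      calc 90 * (m + 1) * (d + 1) ≤ a * a * a := by
            gcongr <;> omega
        _ = a ^ 3 := by ring
    have hlogQ : Real.log ((90 * (m + 1) * (d + 1) : ℕ) : ℝ) ≤ 3 * Real.log a := by
      calc _ ≤ Real.log ((a : ℝ) ^ 3) := Real.log_le_log hQ0 (by exact_mod_cast hQ)
        _ = 3 * Real.log a := by
          rw [Real.log_pow]
          norm_num
    have hRa : R * Real.log a = Real.log p / 2 := by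
      rw [hR]
      field_simp
    calc _ ≤ (272 * (k : ℝ)) * (3 * Real.log a) := by
          refine mul_le_mul hdk hlogQ (Real.log_nonneg ?_) (by positivity)
          exact_mod_cast (by nlinarith : 1 ≤ 90 * (m + 1) * (d + 1))
      _ ≤ (R / 2) * (3 * Real.log a) := by
          gcongr
          linarith
      _ = 3 / 4 * Real.log p := by
          rw [div_mul_eq_mul_div, mul_left_comm, hRa]
          ring
      _ < Real.log p := by linarith

theorem mul_pow_add_one_lt_pow {n k : ℕ} (h : n ≤ k) (hk : 0 < k) :
    n * (3 ^ (16 * k) + 1) < 2 ^ (32 * k) := by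
  have h1 : n < 2 ^ k := lt_of_le_of_lt h Nat.lt_two_pow_self
  have h2 : 3 ^ (16 * k) ≤ 2 ^ (26 * k) := by
    rw [pow_mul, pow_mul]
    exact Nat.pow_le_pow_left (by norm_num) k
  have h3 : 1 ≤ 2 ^ (26 * k) := Nat.one_le_two_pow
  calc n * (3 ^ (16 * k) + 1) < 2 ^ k * (3 ^ (16 * k) + 1) := by gcongr
    _ ≤ 2 ^ k * (2 ^ (26 * k) * 2) := by
      gcongr
      omega
    _ = 2 ^ (k + (26 * k + 1)) := by rw [pow_add, pow_add, pow_one]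
    _ ≤ 2 ^ (32 * k) := Nat.pow_le_pow_right (by norm_num) (by omega)

theorem apply_prod_value {N H : Type*} [CommGroup N] [CommGroup H] {φ : H →* MulAut N}
    [DecidableEq (N ⋊[φ] H)] {k : ℕ} {l : List (SignedBlock (N ⋊[φ] H))}
    (hl : ∀ b ∈ l, b.IsValid k) : φ (l.map SignedBlock.value).prod.2 = 1 := by
  induction l with
  | nil => simp
  | cons b l ih =>
    have hb := hl b List.mem_cons_self
    rw [List.map_cons, List.prod_cons, Prod.snd_mul, map_mul,
      ih fun c hc => hl c (List.mem_cons_of_mem _ hc), mul_one]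
    exact apply_alternatingValue_snd hb.card_eq hb.odd_sign hb.even_sign

theorem exists_floor_bounds {n p : ℕ} (hp : ⌈Real.exp ((1120 * ((n : ℝ) + 3)) ^ 2)⌉₊ ≤ p) {R x : ℝ}
    (hR : R = (1 / 2 : ℝ) * max (Real.log p ^ ((1 : ℝ) / 2)) x) :
    0 < Real.log p ∧ ∃ k : ℕ, n + 3 ≤ k ∧ 560 * (k : ℝ) ≤ R ∧ R ≤ 1120 * k := by
  have h1 : (1120 * ((n : ℝ) + 3)) ^ 2 ≤ Real.log p := by
    have h2 : Real.exp ((1120 * ((n : ℝ) + 3)) ^ 2) ≤ p :=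
      (Nat.le_ceil _).trans (by exact_mod_cast hp)
    rwa [Real.le_log_iff_exp_le ((Real.exp_pos _).trans_le h2)]
  have h3 : 1120 * ((n : ℝ) + 3) ≤ Real.log p ^ ((1 : ℝ) / 2) := by
    rw [← Real.sqrt_eq_rpow]
    exact Real.le_sqrt_of_sq_le h1
  have h4 : 560 * ((n : ℝ) + 3) ≤ R := by
    rw [hR]
    linarith [le_max_left (Real.log p ^ ((1 : ℝ) / 2)) x]
  have hn : (0 : ℝ) ≤ n := n.cast_nonneg
  have hR0 : 0 ≤ R / 560 := by linarith
  refine ⟨lt_of_lt_of_le (by positivity) h1, ⌊R / 560⌋₊, ?_, ?_, ?_⟩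
  · refine Nat.le_floor ?_
    push_cast
    linarith
  · linarith [Nat.floor_le hR0]
  · have h5 : ((n + 3 : ℕ) : ℝ) ≤ ⌊R / 560⌋₊ := by
      refine Nat.cast_le.2 (Nat.le_floor ?_)
      push_cast
      linarith
    push_cast at h5
    linarith [Nat.lt_floor_add_one (R / 560)]

theorem abs_mul_lt_iff_bounds {p m : ℕ} {k : ℤ} (h : |k| * (90 * (m + 1)) < p) :
    -((p : ℝ) / (90 * (m + 1))) < (k : ℝ) ∧ (k : ℝ) < (p : ℝ) / (90 * (m + 1)) := by
  rw [← abs_lt, lt_div_iff₀ (by positivity)]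
  exact_mod_cast h

/-- the structure theorem for subsets of `ℤ/p ⋊_φ H`. -/
theorem statement10 (H : Type*) [CommGroup H] [Fintype H] (hH : StronglySequenceable H) :
    ∃ (c₁ C₁ C₂ : ℝ) (p₀ : ℕ), 0 < c₁ ∧ 0 < C₁ ∧ C₁ ≤ C₂ ∧
      ∀ p : ℕ, p.Prime → p₀ ≤ p →
      ∀ φ : H →* MulAut (Multiplicative (ZMod p)), PropertyStar φ →
      ∀ A : Finset (Multiplicative (ZMod p) ⋊[φ] H), A.Nonempty →
        (1 : Multiplicative (ZMod p) ⋊[φ] H) ∉ A →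
        ∃ (ψ : (Multiplicative (ZMod p) ⋊[φ] H) ≃* (Multiplicative (ZMod p) ⋊[φ] H))
          (s : ℕ) (E : Finset (Multiplicative (ZMod p) ⋊[φ] H))
          (D Do De : Fin s → Finset (Multiplicative (ZMod p) ⋊[φ] H))
          (L₀ L₁ : Finset (Fin s)),
          -- `ψ(A) = E ∪ D₁ ∪ ⋯ ∪ D_s` is a partition
          (A.image (fun a => ψ a) = E ∪ Finset.univ.biUnion D) ∧
          (∀ j, Disjoint E (D j)) ∧
          (∀ i j, i ≠ j → Disjoint (D i) (D j)) ∧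
          -- `{1, …, s} = L₀ ∪ L₁` is a partition
          Disjoint L₀ L₁ ∧ L₀ ∪ L₁ = Finset.univ ∧
          -- for `j ∈ L₁`, `D j = Do j ∪ De j` is a partition into halves
          (∀ j ∈ L₁, Disjoint (Do j) (De j) ∧ Do j ∪ De j = D j ∧
            (Do j).card = (De j).card) ∧
          -- (i)
          (dimension E : ℝ) <
            c₁ * max (Real.log p ^ ((1 : ℝ) / 2)) (Real.log p / Real.log A.card) ∧
          -- the remaining properties, when `s > 0`
          (∀ hs : 0 < s,
            -- (ii)
            (∀ j, IsDissociated ((D j : Set (Multiplicative (ZMod p) ⋊[φ] H))) ∧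
              C₁ * (c₁ * max (Real.log p ^ ((1 : ℝ) / 2))
                  (Real.log p / Real.log A.card)) ≤ ((D j).card : ℝ) ∧
              ((D j).card : ℝ) ≤ C₂ * (c₁ * max (Real.log p ^ ((1 : ℝ) / 2))
                  (Real.log p / Real.log A.card)) ∧
              8 ∣ (D j).card) ∧
            -- (iii)
            ((⟨0, hs⟩ : Fin s) ∈ L₀ ↔ (⟨s - 1, by omega⟩ : Fin s) ∈ L₀) ∧
            (∀ j ∈ L₁, ∀ d ∈ D j,
              φ (SemidirectProduct.right d) = MulEquiv.inv (Multiplicative (ZMod p))) ∧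
            (∀ j ∈ L₀, ∀ d ∈ D j, φ (SemidirectProduct.right d) = 1) ∧
            -- (iv) and (v)
            ∃ δ : Multiplicative (ZMod p) ⋊[φ] H,
              (∀ (lo le : Fin s → List (Multiplicative (ZMod p) ⋊[φ] H))
                  (l₁ l₀ : List (Fin s)),
                l₁.Nodup → l₁.toFinset = L₁ → l₀.Nodup → l₀.toFinset = L₀ →
                (∀ j ∈ L₁, (lo j).Nodup ∧ (lo j).toFinset = Do j ∧
                  (le j).Nodup ∧ (le j).toFinset = De j) →
                (∀ j ∈ L₀, (lo j).Nodup ∧ (lo j).toFinset = D j) →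
                (l₁.map fun j => (interleave (lo j) (le j)).prod).prod *
                  (l₀.map fun j => (lo j).prod).prod = δ) ∧
              SemidirectProduct.left δ ≠ 1 ∧
              φ (SemidirectProduct.right δ) = 1 ∧
              (∀ g ∈ insert δ E, ∃ k : ℤ,
                ((k : ZMod p) = Multiplicative.toAdd (SemidirectProduct.left g)) ∧
                -((p : ℝ) / (90 * (E.card + 1))) < (k : ℝ) ∧
                (k : ℝ) < (p : ℝ) / (90 * (E.card + 1))) ∧
              IsDissociated
                ((D ⟨0, hs⟩ ∪ D ⟨s - 1, by omega⟩ ∪ {δ} :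
                  Finset (Multiplicative (ZMod p) ⋊[φ] H)) :
                  Set (Multiplicative (ZMod p) ⋊[φ] H))) := by
  refine ⟨1 / 2, 1 / 140, 1, ⌈Real.exp ((1120 * ((Fintype.card H : ℝ) + 3)) ^ 2)⌉₊,
    by norm_num, by norm_num, by norm_num, ?_⟩
  intro p hp hp₀ φ hstar A hA _
  have : Fact p.Prime := ⟨hp⟩
  have hφ : ∀ h : H, ∃ t : ℤˣ, ∀ x, φ h x = x ^ (t : ℤ) := by
    intro h
    rcases hstar h with h1 | h1
    · exact ⟨1, fun x => by simp [h1]⟩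
    · exact ⟨-1, fun x => by simp [h1]⟩
  set R : ℝ := 1 / 2 * max (Real.log p ^ ((1 : ℝ) / 2)) (Real.log p / Real.log A.card) with hR
  obtain ⟨hlog, k, hk3, hkR, hRk⟩ := exists_floor_bounds hp₀ hR
  by_cases hdim : (dimension A : ℝ) < R
  · refine ⟨MulEquiv.refl _, 0, A, Fin.elim0, Fin.elim0, Fin.elim0, ∅, ∅, ?_, ?_, ?_, ?_, ?_, ?_,
      hdim, fun hs => absurd hs (lt_irrefl 0)⟩ <;> simp
  have hkA : 560 * k ≤ dimension A := by
    exact_mod_cast hkR.trans (not_lt.1 hdim)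
  obtain ⟨E, l, hl, hEdim, hvalid, hmem, hEl, hpair, hsign, hne, hdiss⟩ :=
    exists_block_decomposition hφ (by omega : 0 < k)
      (mul_pow_add_one_lt_pow (by omega) (by omega)) A hkA
  set δ : Multiplicative (ZMod p) ⋊[φ] H :=
    ⟨(l.map SignedBlock.value).prod.1, (l.map SignedBlock.value).prod.2⟩ with hδ
  have hv : ∀ j : Fin l.length, l[j].IsValid k := fun j => hvalid _ (List.getElem_mem _)
  have hEA : E.card + 1 ≤ A.card := by
    refine Finset.card_lt_card ⟨fun x hx => (hmem x).2 (Or.inl hx), fun h => ?_⟩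
    have h0 := hv ⟨0, hl⟩
    obtain ⟨x, hx⟩ : (l[0].support).Nonempty := by
      rw [← Finset.card_pos]
      exact lt_of_lt_of_le (by omega) h0.le_card
    exact Finset.disjoint_left.1 (hEl _ (List.getElem_mem _))
      (h ((hmem x).2 (Or.inr ⟨_, List.getElem_mem _, hx⟩))) hx
  obtain ⟨u, hu, hδu, hEu⟩ := exists_scaling_small hφ E δ
    (pow_lt_of_log_bound Fintype.card_pos hp.pos hR hlog hkR hk3 hEdim (card_le_of_dimension hφ E)
      hEA (hkA.trans (dimension_le_of_forall fun D hD _ => Finset.card_le_card hD)))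
  obtain ⟨ψ, hψ⟩ := exists_scaling_equiv hφ hu
  have hinj : Function.Injective fun a => ψ a := ψ.injective
  have hcardE : (E.image fun a => ψ a).card = E.card := Finset.card_image_of_injective _ hinj
  have hdisj : ∀ i j : Fin l.length, i ≠ j → Disjoint l[i].support l[j].support := by
    intro i j hij
    rcases lt_or_gt_of_ne hij with h | h
    · exact List.pairwise_iff_getElem.1 hpair i j i.2 j.2 h
    · exact (List.pairwise_iff_getElem.1 hpair j i j.2 i.2 h).symm
  have hsgn : ∀ j : Fin l.length, ∀ g ∈ l[j].support, HasSign l[j].sign g := by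
    intro j g hg
    rcases Finset.mem_union.1 hg with h | h
    · exact (hv j).odd_sign g h
    · exact (hv j).even_sign g h
  have hprod : ∏ j : Fin l.length, alternatingValue l[j].sign l[j].odd l[j].even =
      (l.map SignedBlock.value).prod :=
    Fin.prod_univ_fun_getElem l SignedBlock.value
  have halt := (isAlternatingProduct_of_hasSign (s := l.length) (Do := fun j => l[j].odd)
    (De := fun j => l[j].even) (t := fun j => l[j].sign) (fun j => (hv j).disjoint)
    (fun j => (hv j).card_eq) (fun j => (hv j).odd_sign) fun j => (hv j).even_sign).image ψ
  simp only [hprod] at halt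
  refine ⟨ψ, l.length, E.image fun a => ψ a, fun j => l[j].support.image fun a => ψ a,
    fun j => l[j].odd.image fun a => ψ a, fun j => l[j].even.image fun a => ψ a,
    Finset.univ.filter fun j => l[j].sign = 1, Finset.univ.filter fun j => l[j].sign ≠ 1,
    ?_, ?_, ?_, ?_, ?_, ?_, ?_, fun hs => ⟨?_, ?_, ?_, ?_, ψ δ, halt, ?_, ?_, ?_, ?_⟩⟩
  · ext x
    simp only [Finset.mem_image, Finset.mem_union, Finset.mem_biUnion, Finset.mem_univ, true_and,
      hmem, List.mem_iff_getElem]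
    constructor
    · rintro ⟨a, ha | ⟨b, ⟨i, hi, rfl⟩, hb⟩, rfl⟩
      · exact Or.inl ⟨a, ha, rfl⟩
      · exact Or.inr ⟨⟨i, hi⟩, a, hb, rfl⟩
    · rintro (⟨a, ha, rfl⟩ | ⟨i, a, ha, rfl⟩)
      · exact ⟨a, Or.inl ha, rfl⟩
      · exact ⟨a, Or.inr ⟨_, ⟨i, i.2, rfl⟩, ha⟩, rfl⟩
  · exact fun j => (Finset.disjoint_image hinj).2 (hEl _ (List.getElem_mem _))
  · exact fun i j hij => (Finset.disjoint_image hinj).2 (hdisj i j hij)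
  · exact Finset.disjoint_filter_filter_not _ _ _
  · exact Finset.filter_union_filter_not_eq _ _
  · intro j _
    refine ⟨(Finset.disjoint_image hinj).2 (hv j).disjoint, ?_, ?_⟩
    · rw [← Finset.image_union]
      rfl
    · simp only [Finset.card_image_of_injective _ hinj, (hv j).card_eq]
  · refine lt_of_le_of_lt (Nat.cast_le.2 (dimension_image_le ψ E)) ?_
    have h1 : (dimension E : ℝ) < 272 * k := by exact_mod_cast hEdim
    linarith [k.cast_nonneg (α := ℝ)]
  · intro j
    have h1 : (8 * k : ℝ) ≤ l[j].support.card := by exact_mod_cast (hv j).le_card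
    have h2 : (l[j].support.card : ℝ) ≤ 264 * k := by exact_mod_cast (hv j).card_le
    rw [Finset.card_image_of_injective _ hinj, Finset.coe_image]
    refine ⟨(hv j).dissociated.image ψ, ?_, ?_, (hv j).dvd⟩
    · linarith
    · linarith [k.cast_nonneg (α := ℝ)]
  · simp only [Finset.mem_filter, Finset.mem_univ, true_and]
    simp only [Fin.getElem_fin, hsign]
  · intro j hj d hd
    obtain ⟨a, ha, rfl⟩ := Finset.mem_image.1 hd
    have ht := (Int.units_eq_one_or _).resolve_left (Finset.mem_filter.1 hj).2
    rw [(hψ a).2]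
    ext x
    rw [hsgn j a ha x, ht]
    simp
  · intro j hj d hd
    obtain ⟨a, ha, rfl⟩ := Finset.mem_image.1 hd
    have ht := (Finset.mem_filter.1 hj).2
    rw [(hψ a).2]
    ext x
    rw [hsgn j a ha x, ht]
    simp
  · intro h
    have h1 := (hψ δ).1
    rw [h, toAdd_one, eq_comm, mul_eq_zero, toAdd_eq_zero] at h1
    exact hne (h1.resolve_left hu)
  · rw [(hψ δ).2]
    exact apply_prod_value hvalid
  · intro g hg
    rw [hcardE]
    rcases Finset.mem_insert.1 hg with rfl | hg
    · obtain ⟨c, hc, hcp⟩ := hδu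
      exact ⟨c, by rw [hc, (hψ δ).1], abs_mul_lt_iff_bounds hcp⟩
    · obtain ⟨a, ha, rfl⟩ := Finset.mem_image.1 hg
      obtain ⟨c, hc, hcp⟩ := hEu a ha
      exact ⟨c, by rw [hc, (hψ a).1], abs_mul_lt_iff_bounds hcp⟩
  · have h1 := hdiss.image ψ
    rw [← Finset.coe_image, Finset.image_union, Finset.image_union, Finset.image_singleton] at h1
    exact h1
end

section
/- Let p be a prime and let G = Z_p ⋊_φ H where H is abelian and φ satisfies property (⋆). Let D ⊆ G be a dissociated set with π_2(d) ∈ H_1 for every d ∈ D, and let D = D^o ∪ D^e be a partition with |D^o| = ⌈|D|/2⌉ and |D^e| = ⌊|D|/2⌋. Let d_1, …, d_h and d'_1, …, d'_ℓ be two sequences of pairwise distinct elements of D such that d_k, d'_k ∈ D^o whenever k is odd and d_k, d'_k ∈ D^e whenever k is even. If the underlying sets {d_1, …, d_h} and {d'_1, …, d'_ℓ} are different, then d_1·d_2⋯d_h ≠ d'_1·d'_2⋯d'_ℓ. -/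
open scoped Classical

/-- The list `s₀, t₀, s₁, t₁, …` alternating between two lists, stopping as soon as the list
whose turn it is has no entry left. -/
def alternate {α : Type*} : List α → List α → List α
  | [], _ => []
  | a :: s, t => a :: alternate t s
termination_by s t => s.length + t.length

theorem alternate_perm_append {α : Type*} (s t : List α) (hts : t.length ≤ s.length)
    (hst : s.length ≤ t.length + 1) : (alternate s t).Perm (s ++ t) := by
  induction s, t using alternate.induct with
  | case1 t =>
    have : t = [] := List.length_eq_zero_iff.mp (by simpa using hts)
    simp [alternate, this]
  | case2 a s t ih =>
    rw [alternate, List.cons_append]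
    simp only [List.length_cons] at hts hst
    exact ((ih (by omega) (by omega)).trans List.perm_append_comm).cons a

theorem map_alternate {α β : Type*} (f : α → β) (s t : List α) :
    (alternate s t).map f = alternate (s.map f) (t.map f) := by
  induction s, t using alternate.induct with
  | case1 t => simp [alternate]
  | case2 a s t ih => simp [alternate, ih]

theorem exists_eq_alternate {α : Type*} (l : List α) (A B : Finset α)
    (h : ∀ i : Fin l.length, if i.1 % 2 = 0 then l.get i ∈ A else l.get i ∈ B) :
    ∃ s t : List α, l = alternate s t ∧ t.length ≤ s.length ∧ s.length ≤ t.length + 1 ∧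
      (∀ a ∈ s, a ∈ A) ∧ ∀ a ∈ t, a ∈ B := by
  induction l generalizing A B with
  | nil => exact ⟨[], [], by simp [alternate]⟩
  | cons a l ih =>
    obtain ⟨s, t, hl, hts, hst, hs, ht⟩ := ih B A fun i ↦ by
      have hi := h i.succ
      simp only [Fin.val_succ, List.get_cons_succ'] at hi
      rcases Nat.mod_two_eq_zero_or_one i.1 with h2 | h2
      · simpa [h2, Nat.add_mod] using hi
      · simpa [h2, Nat.add_mod] using hi
    refine ⟨a :: t, s, by rw [alternate, hl], by simpa using hst, by simpa using hts, ?_, hs⟩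
    have ha : a ∈ A := by simpa using h ⟨0, by simp⟩
    simpa [ha] using ht

section SemidirectProduct

open SemidirectProduct

variable {N H : Type*} [CommGroup N] [CommGroup H] {φ : H →* MulAut N}

theorem right_list_prod (l : List (N ⋊[φ] H)) : l.prod.right = (l.map right).prod :=
  map_list_prod (rightHom : N ⋊[φ] H →* H) l

theorem left_prod_alternate (s t : List (N ⋊[φ] H))
    (hs : ∀ d ∈ s, φ d.right = MulEquiv.inv N) (ht : ∀ d ∈ t, φ d.right = MulEquiv.inv N)
    (hts : t.length ≤ s.length) (hst : s.length ≤ t.length + 1) :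
    (alternate s t).prod.left = (s.map left).prod / (t.map left).prod := by
  induction s, t using alternate.induct with
  | case1 t =>
    have : t = [] := List.length_eq_zero_iff.mp (by simpa using hts)
    simp [alternate, this]
  | case2 a s t ih =>
    simp only [List.length_cons] at hts hst
    rw [alternate, List.prod_cons, mul_left, hs a (by simp),
      ih ht (fun d hd ↦ hs d (by simp [hd])) (by omega) hts]
    simp [mul_div_assoc]

theorem right_prod_alternate (s t : List (N ⋊[φ] H))
    (hts : t.length ≤ s.length) (hst : s.length ≤ t.length + 1) :
    (alternate s t).prod.right = (s.map right).prod * (t.map right).prod := by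
  rw [right_list_prod, ((alternate_perm_append s t hts hst).map right).prod_eq,
    List.map_append, List.prod_append]

theorem left_inv_of_map_right_eq_inv (d : N ⋊[φ] H) (hd : φ d.right = MulEquiv.inv N) :
    d⁻¹.left = d.left := by
  have h : (MulEquiv.inv N)⁻¹ = MulEquiv.inv N := by ext x; rfl
  rw [inv_left, map_inv φ, hd, h]
  simp

theorem map_right_inv_eq_inv (d : N ⋊[φ] H) (hd : φ d.right = MulEquiv.inv N) :
    φ d⁻¹.right = MulEquiv.inv N := by
  rw [inv_right, map_inv, hd]
  ext x; rfl

/-- The elements of `S` with exponent `1`, followed by those of `T` with exponent `-1`. -/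
noncomputable def signedList {G : Type*} (S T : Finset G) : List (G × ℤ) :=
  S.toList.map (·, 1) ++ T.toList.map (·, -1)

theorem mem_signedList {G : Type*} {S T : Finset G} {x : G × ℤ} :
    x ∈ signedList S T ↔ (x.1 ∈ S ∧ x.2 = 1) ∨ (x.1 ∈ T ∧ x.2 = -1) := by
  obtain ⟨a, e⟩ := x
  simp [signedList, eq_comm]

theorem length_signedList {G : Type*} (S T : Finset G) :
    (signedList S T).length = S.card + T.card := by
  simp [signedList]

theorem map_fst_signedList {G : Type*} (S T : Finset G) :
    (signedList S T).map Prod.fst = S.toList ++ T.toList := by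
  simp [signedList, Function.comp_def]

theorem prod_left_signedList (S T : Finset (N ⋊[φ] H))
    (hT : ∀ d ∈ T, φ d.right = MulEquiv.inv N) :
    (((signedList S T).map fun x ↦ x.1 ^ x.2).map left).prod =
      (∏ d ∈ S, d.left) * ∏ d ∈ T, d.left := by
  have h : T.toList.map (fun d ↦ d⁻¹.left) = T.toList.map left :=
    List.map_congr_left fun d hd ↦ left_inv_of_map_right_eq_inv d (hT d (by simpa using hd))
  simp [signedList, Function.comp_def, -inv_left, h, Finset.prod_map_toList]

theorem prod_right_signedList (S T : Finset (N ⋊[φ] H)) :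
    (((signedList S T).map fun x ↦ x.1 ^ x.2).map right).prod =
      (∏ d ∈ S, d.right) / ∏ d ∈ T, d.right := by
  simp [signedList, Function.comp_def, Finset.prod_map_toList, div_eq_mul_inv]

/-- Two signed lists with alternating product `1` contradict dissociativity. -/
theorem IsDissociated.false_of_signedList {D P Q P' Q' : Finset (N ⋊[φ] H)}
    (hD : IsDissociated (D : Set (N ⋊[φ] H)))
    (hinv : ∀ d ∈ D, φ d.right = MulEquiv.inv N)
    (hP : P ⊆ D) (hQ : Q ⊆ D) (hP' : P' ⊆ D) (hQ' : Q' ⊆ D)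
    (hnodup : (P.toList ++ Q.toList ++ (P'.toList ++ Q'.toList)).Nodup)
    (hle : P'.card + Q'.card ≤ P.card + Q.card)
    (hle' : P.card + Q.card ≤ P'.card + Q'.card + 1)
    (hpos : 0 < P.card + Q.card)
    (hleft : (∏ d ∈ P, d.left) * ∏ d ∈ Q, d.left = (∏ d ∈ P', d.left) * ∏ d ∈ Q', d.left)
    (hright : ((∏ d ∈ P, d.right) / ∏ d ∈ Q, d.right) *
      ((∏ d ∈ P', d.right) / ∏ d ∈ Q', d.right) = 1) : False := by
  have hlen : (signedList P' Q').length ≤ (signedList P Q).length := by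
    simpa [length_signedList] using hle
  have hlen' : (signedList P Q).length ≤ (signedList P' Q').length + 1 := by
    simpa [length_signedList] using hle'
  have hperm := alternate_perm_append _ _ hlen hlen'
  have hmem : ∀ {S T : Finset (N ⋊[φ] H)}, S ⊆ D → T ⊆ D → ∀ x ∈ signedList S T,
      x.1 ∈ D ∧ (x.2 = 1 ∨ x.2 = -1) := by
    intro S T hS hT x hx
    rcases mem_signedList.mp hx with ⟨h, h'⟩ | ⟨h, h'⟩
    · exact ⟨hS h, .inl h'⟩
    · exact ⟨hT h, .inr h'⟩
  have hmap : ∀ {S T : Finset (N ⋊[φ] H)}, S ⊆ D → T ⊆ D →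
      ∀ d ∈ (signedList S T).map fun x ↦ x.1 ^ x.2, φ d.right = MulEquiv.inv N := by
    intro S T hS hT d hd
    obtain ⟨x, hx, rfl⟩ := List.mem_map.mp hd
    obtain ⟨hxD, h | h⟩ := hmem hS hT x hx
    · simpa [h] using hinv _ hxD
    · rw [h, zpow_neg_one]
      exact map_right_inv_eq_inv _ (hinv _ hxD)
  refine hD (alternate (signedList P Q) (signedList P' Q')) ?_ ?_ ?_ ?_
  · intro h
    have hnil := List.perm_nil.mp (h ▸ hperm).symm
    have hlen0 := congrArg List.length hnil
    simp only [List.length_append, length_signedList, List.length_nil] at hlen0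
    omega
  · rw [(hperm.map Prod.fst).nodup_iff, List.map_append, map_fst_signedList, map_fst_signedList]
    exact hnodup
  · intro x hx
    rcases List.mem_append.mp (hperm.mem_iff.mp hx) with h | h
    · exact hmem hP hQ x h
    · exact hmem hP' hQ' x h
  · rw [map_alternate]
    ext
    · rw [left_prod_alternate _ _ (hmap hP hQ) (hmap hP' hQ') (by simpa using hlen)
        (by simpa using hlen'), prod_left_signedList _ _ fun d hd ↦ hinv d (hQ hd),
        prod_left_signedList _ _ fun d hd ↦ hinv d (hQ' hd), hleft, div_self', one_left]
    · rw [right_prod_alternate _ _ (by simpa using hlen) (by simpa using hlen'),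
        prod_right_signedList, prod_right_signedList, hright, one_right]

end SemidirectProduct

/-- distinct alternating products from a dissociated set.  If
`D = D^o ∪ D^e` is a dissociated set in `ℤ/p ⋊_φ H` with all `H`-components in `H₁`,
`|D^o| = ⌈|D|/2⌉`, `|D^e| = ⌊|D|/2⌋`, then two sequences of pairwise distinct elements
taking odd-position entries in `D^o` and even-position entries in `D^e`, with distinct
underlying sets, have distinct products. -/
theorem statement11 (p : ℕ) (hp : p.Prime) (H : Type*) [CommGroup H]
    (φ : H →* MulAut (Multiplicative (ZMod p))) (hφ : PropertyStar φ)
    (Do De : Finset (Multiplicative (ZMod p) ⋊[φ] H)) (hdisj : Disjoint Do De)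
    (hdiss : IsDissociated ((Do ∪ De : Finset (Multiplicative (ZMod p) ⋊[φ] H)) :
      Set (Multiplicative (ZMod p) ⋊[φ] H)))
    (hmem : ∀ d ∈ Do ∪ De,
      φ (SemidirectProduct.right d) = MulEquiv.inv (Multiplicative (ZMod p)))
    (ho : Do.card = ((Do ∪ De).card + 1) / 2) (he : De.card = (Do ∪ De).card / 2)
    (l₁ l₂ : List (Multiplicative (ZMod p) ⋊[φ] H)) (h₁ : l₁.Nodup) (h₂ : l₂.Nodup)
    (hpos₁ : ∀ i : Fin l₁.length, if i.1 % 2 = 0 then l₁.get i ∈ Do else l₁.get i ∈ De)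
    (hpos₂ : ∀ i : Fin l₂.length, if i.1 % 2 = 0 then l₂.get i ∈ Do else l₂.get i ∈ De)
    (hne : l₁.toFinset ≠ l₂.toFinset) :
    l₁.prod ≠ l₂.prod := by
  obtain ⟨s₁, t₁, rfl, hts₁, hst₁, hs₁, ht₁⟩ := exists_eq_alternate l₁ Do De hpos₁
  obtain ⟨s₂, t₂, rfl, hts₂, hst₂, hs₂, ht₂⟩ := exists_eq_alternate l₂ Do De hpos₂
  intro hprod
  have perm₁ := alternate_perm_append s₁ t₁ hts₁ hst₁
  have perm₂ := alternate_perm_append s₂ t₂ hts₂ hst₂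
  obtain ⟨ns₁, nt₁, -⟩ := List.nodup_append.mp (perm₁.nodup_iff.mp h₁)
  obtain ⟨ns₂, nt₂, -⟩ := List.nodup_append.mp (perm₂.nodup_iff.mp h₂)
  have hmo : ∀ d ∈ Do, φ d.right = MulEquiv.inv _ := fun d hd ↦ hmem d (by simp [hd])
  have hme : ∀ d ∈ De, φ d.right = MulEquiv.inv _ := fun d hd ↦ hmem d (by simp [hd])
  have hleft := congrArg SemidirectProduct.left hprod
  rw [left_prod_alternate _ _ (fun d hd ↦ hmo d (hs₁ d hd)) (fun d hd ↦ hme d (ht₁ d hd)) hts₁ hst₁,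
    left_prod_alternate _ _ (fun d hd ↦ hmo d (hs₂ d hd)) (fun d hd ↦ hme d (ht₂ d hd)) hts₂ hst₂,
    ← List.prod_toFinset _ ns₁, ← List.prod_toFinset _ nt₁,
    ← List.prod_toFinset _ ns₂, ← List.prod_toFinset _ nt₂] at hleft
  have hright := congrArg SemidirectProduct.right hprod
  rw [right_prod_alternate _ _ hts₁ hst₁, right_prod_alternate _ _ hts₂ hst₂,
    ← List.prod_toFinset _ ns₁, ← List.prod_toFinset _ nt₁,
    ← List.prod_toFinset _ ns₂, ← List.prod_toFinset _ nt₂] at hright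
  rw [List.toFinset_eq_of_perm _ _ perm₁, List.toFinset_eq_of_perm _ _ perm₂,
    List.toFinset_append, List.toFinset_append] at hne
  rw [← List.toFinset_card_of_nodup ns₁, ← List.toFinset_card_of_nodup nt₁] at hts₁ hst₁
  rw [← List.toFinset_card_of_nodup ns₂, ← List.toFinset_card_of_nodup nt₂] at hts₂ hst₂
  have hS₁ : s₁.toFinset ⊆ Do := fun d hd ↦ hs₁ d (List.mem_toFinset.mp hd)
  have hT₁ : t₁.toFinset ⊆ De := fun d hd ↦ ht₁ d (List.mem_toFinset.mp hd)
  have hS₂ : s₂.toFinset ⊆ Do := fun d hd ↦ hs₂ d (List.mem_toFinset.mp hd)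
  have hT₂ : t₂.toFinset ⊆ De := fun d hd ↦ ht₂ d (List.mem_toFinset.mp hd)
  generalize s₁.toFinset = S₁ at *
  generalize t₁.toFinset = T₁ at *
  generalize s₂.toFinset = S₂ at *
  generalize t₂.toFinset = T₂ at *
  have hcS : (S₁ \ S₂).card + S₂.card = (S₂ \ S₁).card + S₁.card := by
    rw [Finset.card_sdiff_add_card, Finset.card_sdiff_add_card, Finset.union_comm]
  have hcT : (T₁ \ T₂).card + T₂.card = (T₂ \ T₁).card + T₁.card := by
    rw [Finset.card_sdiff_add_card, Finset.card_sdiff_add_card, Finset.union_comm]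
  have hl : (∏ d ∈ S₁ \ S₂, d.left) * ∏ d ∈ T₂ \ T₁, d.left =
      (∏ d ∈ T₁ \ T₂, d.left) * ∏ d ∈ S₂ \ S₁, d.left := by
    rw [← div_eq_div_iff_mul_eq_mul,
      Finset.prod_sdiff_div_prod_sdiff, Finset.prod_sdiff_div_prod_sdiff,
      div_eq_div_iff_mul_eq_mul]
    rw [div_eq_div_iff_mul_eq_mul] at hleft
    rw [hleft, mul_comm]
  have hr : ((∏ d ∈ S₁ \ S₂, d.right) / ∏ d ∈ T₂ \ T₁, d.right) *
      ((∏ d ∈ T₁ \ T₂, d.right) / ∏ d ∈ S₂ \ S₁, d.right) = 1 := by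
    rw [div_mul_div_comm, mul_comm (∏ d ∈ T₂ \ T₁, d.right), ← div_mul_div_comm,
      Finset.prod_sdiff_div_prod_sdiff, Finset.prod_sdiff_div_prod_sdiff, div_mul_div_comm,
      hright, div_self']
  have hSs₁ : S₁ \ S₂ ⊆ Do := Finset.sdiff_subset.trans hS₁
  have hSs₂ : S₂ \ S₁ ⊆ Do := Finset.sdiff_subset.trans hS₂
  have hTs₁ : T₁ \ T₂ ⊆ De := Finset.sdiff_subset.trans hT₁
  have hTs₂ : T₂ \ T₁ ⊆ De := Finset.sdiff_subset.trans hT₂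
  have ho' : Do ⊆ Do ∪ De := Finset.subset_union_left
  have he' : De ⊆ Do ∪ De := Finset.subset_union_right
  have hnodup : ((S₁ \ S₂).toList ++ (T₂ \ T₁).toList ++
      ((T₁ \ T₂).toList ++ (S₂ \ S₁).toList)).Nodup := by
    have hd : ∀ d ∈ Do, d ∉ De := fun _ hd ↦ Finset.disjoint_left.mp hdisj hd
    simp only [List.nodup_append, Finset.nodup_toList, Finset.mem_toList, List.mem_append,
      Finset.mem_sdiff]
    grind
  have hpos : 0 < (S₁ \ S₂).card + (T₂ \ T₁).card + ((T₁ \ T₂).card + (S₂ \ S₁).card) := by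
    by_contra h
    simp only [not_lt, nonpos_iff_eq_zero, Nat.add_eq_zero_iff, Finset.card_eq_zero,
      Finset.sdiff_eq_empty_iff_subset] at h
    obtain ⟨⟨a, b⟩, c, d⟩ := h
    exact hne (by rw [a.antisymm d, c.antisymm b])
  rcases le_total ((T₁ \ T₂).card + (S₂ \ S₁).card) ((S₁ \ S₂).card + (T₂ \ T₁).card) with h | h
  · exact hdiss.false_of_signedList hmem (hSs₁.trans ho') (hTs₂.trans he') (hTs₁.trans he')
      (hSs₂.trans ho') hnodup h (by omega)
      (by omega) hl hr
  · exact hdiss.false_of_signedList hmem (hTs₁.trans he') (hSs₂.trans ho') (hSs₁.trans ho')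
      (hTs₂.trans he') (List.perm_append_comm.nodup_iff.mp hnodup) h (by omega)
      (by omega) hl.symm (by rw [mul_comm]; exact hr)
end
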